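/- arXiv:1310.6482 — 2 statements merged into one kernel-verified Lean document; each statement's English description precedes it below -/
import Mathlib

section
/- There exists an absolute constant C > 0 with the following property: for every integer n ≥ 1, every finite set E ⊆ ℝⁿ, and every M ≥ 1 which is a power of two, there exist a non-zero polynomial P ∈ ℝ[x₁,…,xₙ] of total degree at most C·n²·M^(1/n), and pairwise disjoint sets Ω₁,…,Ω_M ⊆ ℝⁿ, such that ℝⁿ is the union of the zero set {x ∈ ℝⁿ : P(x) = 0} and Ω₁,…,Ω_M, each Ωᵢ has topological frontier contained in {x ∈ ℝⁿ : P(x) = 0}, and |E ∩ Ωᵢ| ≤ |E|/M for every i = 1,…,M. -/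
open Finset Function in
/-- Telescoping along the linear order induced by an injective real-valued function. -/
theorem sum_sublevel_sub_sublevel {ι A : Type*} [DecidableEq ι] [AddCommGroup A] (t : ι → ℝ)
    (G : Finset ι → A) (X : Finset ι) (ht : Set.InjOn t X) :
    ∑ x ∈ X, (G {y ∈ X | t y ≤ t x} - G {y ∈ X | t y < t x}) = G X - G ∅ := by
  induction X using Finset.induction_on_max_value t with
  | empty => simp
  | insert a s ha hmax ih =>
    have hlt : ∀ x ∈ s, t x < t a := fun x hx => lt_of_le_of_ne (hmax x hx) fun h =>
      ha (ht (by simp [hx]) (by simp) h ▸ hx)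
    rw [sum_insert ha]
    have h1 : {y ∈ insert a s | t y ≤ t a} = insert a s := by
      apply filter_true_of_mem
      intro y hy
      rcases mem_insert.1 hy with rfl | hy
      · exact le_rfl
      · exact hmax y hy
    have h2 : {y ∈ insert a s | t y < t a} = s := by
      rw [filter_insert, if_neg (lt_irrefl _)]
      exact filter_true_of_mem hlt
    have h3 : ∑ x ∈ s, (G {y ∈ insert a s | t y ≤ t x} - G {y ∈ insert a s | t y < t x}) =
        ∑ x ∈ s, (G {y ∈ s | t y ≤ t x} - G {y ∈ s | t y < t x}) := by
      apply sum_congr rfl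
      intro x hx
      rw [filter_insert, if_neg (hlt x hx).not_ge, filter_insert, if_neg (hlt x hx).not_gt]
    rw [h1, h2, h3, ih (ht.mono (by simp))]
    abel

/-- The parity of a sum of signs is the parity of the number of nonzero terms. -/
theorem odd_sum_sign_iff {ι : Type*} (s : Finset ι) (f : ι → ℝ) :
    Odd (∑ y ∈ s, (SignType.sign (f y) : ℤ)) ↔ Odd (s.filter fun y => f y ≠ 0).card := by
  classical
  induction s using Finset.induction_on with
  | empty => simp
  | insert a s ha ih =>
    rw [Finset.sum_insert ha, Finset.filter_insert]
    rcases lt_trichotomy (f a) 0 with h | h | h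
    · rw [if_pos h.ne, Finset.card_insert_of_notMem (by simp [ha]), sign_neg h]
      simp only [SignType.coe_neg, SignType.coe_one]
      grind
    · simpa [h] using ih
    · rw [if_pos h.ne', Finset.card_insert_of_notMem (by simp [ha]), sign_pos h]
      simp only [SignType.coe_one]
      grind

section Node

variable {ι : Type*}

/-- Any `m ≤ K` of the functionals are linearly independent on the span of the first `m`
coordinate directions. -/
def GeneralPosition (ℓ : ι → (ℕ → ℝ) →ₗ[ℝ] ℝ) (K : ℕ) : Prop :=
  ∀ m ≤ K, ∀ x : Fin m → ι, Function.Injective x → ∀ v : ℕ → ℝ,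
    (∀ j, m ≤ j → v j = 0) → (∀ i, ℓ (x i) v = 0) → v = 0

/-- `v` is the normalized vector in the first `m + 1` coordinate directions annihilated by the `m`
functionals `ℓ (x i)`. -/
def IsNode (ℓ : ι → (ℕ → ℝ) →ₗ[ℝ] ℝ) {m : ℕ} (x : Fin m → ι) (v : ℕ → ℝ) : Prop :=
  v m = 1 ∧ (∀ j, m < j → v j = 0) ∧ ∀ i, ℓ (x i) v = 0

/-- A choice of a vector with `IsNode ℓ x`. -/
noncomputable def node (ℓ : ι → (ℕ → ℝ) →ₗ[ℝ] ℝ) {m : ℕ} (x : Fin m → ι) : ℕ → ℝ :=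
  Classical.epsilon (IsNode ℓ x)

variable {ℓ : ι → (ℕ → ℝ) →ₗ[ℝ] ℝ} {K m : ℕ}

theorem GeneralPosition.isNode_node (hℓ : GeneralPosition ℓ K) (hm : m ≤ K) {x : Fin m → ι}
    (hx : Function.Injective x) : IsNode ℓ x (node ℓ x) := by
  apply Classical.epsilon_spec (p := IsNode ℓ x)
  let ext : (Fin m → ℝ) →ₗ[ℝ] (ℕ → ℝ) :=
    { toFun := fun w j => if h : j < m then w ⟨j, h⟩ else 0
      map_add' := by
        intro a b
        ext j
        by_cases h : j < m <;> simp [h]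
      map_smul' := by
        intro a b
        ext j
        by_cases h : j < m <;> simp [h] }
  let T : (Fin m → ℝ) →ₗ[ℝ] (Fin m → ℝ) := LinearMap.pi fun i => (ℓ (x i)).comp ext
  have hT : Function.Injective T := by
    rw [injective_iff_map_eq_zero]
    intro w hw
    have h0 : ext w = 0 := hℓ m hm x hx (ext w) (fun j hj => by simp [ext, hj.not_gt])
      fun i => congrFun hw i
    ext i
    simpa [ext] using congrFun h0 i
  obtain ⟨w, hw⟩ := LinearMap.injective_iff_surjective.1 hT
    (fun i => -ℓ (x i) (Pi.single m 1))
  refine ⟨ext w + Pi.single m 1, by simp [ext], fun j hj => ?_, fun i => ?_⟩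
  · simp [ext, hj.not_gt, Pi.single_eq_of_ne hj.ne']
  · have : ℓ (x i) (ext w) = -ℓ (x i) (Pi.single m 1) := congrFun hw i
    rw [map_add, this, neg_add_cancel]

theorem IsNode.eq_of_annihilates (hℓ : GeneralPosition ℓ K) (hm : m ≤ K) {x y : Fin m → ι}
    (hx : Function.Injective x) {v w : ℕ → ℝ} (hv : IsNode ℓ x v) (hw : IsNode ℓ y w)
    (h : ∀ i, ℓ (x i) w = 0) : v = w := by
  rw [← sub_eq_zero]
  refine hℓ m hm x hx _ (fun j hj => ?_) fun i => by rw [map_sub, hv.2.2, h, sub_zero]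
  rcases hj.eq_or_lt with rfl | hj
  · simp [hv.1, hw.1]
  · simp [hv.2.1 j hj, hw.2.1 j hj]

theorem IsNode.apply_ne_zero (hℓ : GeneralPosition ℓ K) (hm : m + 1 ≤ K) {x : Fin m → ι}
    (hx : Function.Injective x) {v : ℕ → ℝ} (hv : IsNode ℓ x v) {y : ι} (hy : y ∉ Set.range x) :
    ℓ y v ≠ 0 := by
  intro h
  have h0 : v = 0 := hℓ (m + 1) hm (Fin.snoc x y) (Fin.snoc_injective_iff.2 ⟨hx, hy⟩) v
    (fun j hj => hv.2.1 j hj) fun i => by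
      refine Fin.lastCases ?_ (fun i => ?_) i
      · simpa using h
      · simpa using hv.2.2 i
  simpa [h0] using hv.1

/-- Nodes sharing all but one functional lie on a line directed by the node of the common part. -/
theorem node_snoc_sub_node_snoc (hℓ : GeneralPosition ℓ K) (hm : m + 1 ≤ K) {e : Fin m → ι}
    (he : Function.Injective e) {x y : ι} (hx : x ∉ Set.range e) (hy : y ∉ Set.range e) :
    node ℓ (Fin.snoc e x : Fin (m + 1) → ι) - node ℓ (Fin.snoc e y : Fin (m + 1) → ι) =
      (node ℓ (Fin.snoc e x : Fin (m + 1) → ι) m - node ℓ (Fin.snoc e y : Fin (m + 1) → ι) m) •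
        node ℓ e := by
  have hb := hℓ.isNode_node (by omega) he
  have hu := hℓ.isNode_node hm (Fin.snoc_injective_iff.2 ⟨he, hx⟩ :
    Function.Injective (Fin.snoc e x : Fin (m + 1) → ι))
  have hv := hℓ.isNode_node hm (Fin.snoc_injective_iff.2 ⟨he, hy⟩ :
    Function.Injective (Fin.snoc e y : Fin (m + 1) → ι))
  rw [← sub_eq_zero]
  refine hℓ m (by omega) e he _ (fun j hj => ?_) fun i => ?_
  · rcases hj.eq_or_lt with rfl | hj
    · simp [hb.1]
    · rcases (Nat.succ_le_of_lt hj).eq_or_lt with h | h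
      · simp only [Nat.succ_eq_add_one] at h
        subst h
        simp [hu.1, hv.1, hb.2.1 (m + 1) hj]
      · simp [hu.2.1 j h, hv.2.1 j h, hb.2.1 j hj]
  · have h1 := hu.2.2 i.castSucc
    have h2 := hv.2.2 i.castSucc
    simp only [Fin.snoc_castSucc] at h1 h2
    simp [h1, h2, hb.2.2 i]

end Node

section Parity

/-- The mod 2 indicator that the first `k` entries of `a` vanish and the next one is positive. -/
def positiveIndicator (k : ℕ) (a : ℕ → ℤ) : ZMod 2 :=
  if (∀ j < k, a j = 0) ∧ 0 < a k then 1 else 0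

/-- The change of `positiveIndicator k` when the `i`-th entry of `a` is replaced by its two
neighbours. -/
def indicatorJump (k : ℕ) (a : ℕ → ℤ) (i : ℕ) : ZMod 2 :=
  if i = k then (if ∀ j < k + 1, a j = 0 then 1 else 0)
  else if i < k ∧ (a i = 1 ∨ a i = -1) ∧ (∀ j < k, j ≠ i → a j = 0) ∧ 0 < a k then 1 else 0

theorem positiveIndicator_add_sub (k : ℕ) (a : ℕ → ℤ) (i : ℕ) (s : ℤ) (hs : s = 1 ∨ s = -1)
    (ha : i = k → Even (a k)) :
    positiveIndicator k (a + Pi.single i s) - positiveIndicator k (a - Pi.single i s) =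
      indicatorJump k a i := by
  have hadd : ∀ j, j ≠ i → (a + Pi.single i s : ℕ → ℤ) j = a j := fun j hj => by simp [hj]
  have hsub : ∀ j, j ≠ i → (a - Pi.single i s : ℕ → ℤ) j = a j := fun j hj => by simp [hj]
  have hadd' : (a + Pi.single i s : ℕ → ℤ) i = a i + s := by simp
  have hsub' : (a - Pi.single i s : ℕ → ℤ) i = a i - s := by simp
  generalize (a + Pi.single i s : ℕ → ℤ) = u at *
  generalize (a - Pi.single i s : ℕ → ℤ) = w at *
  unfold positiveIndicator indicatorJump
  rcases lt_trichotomy i k with h | rfl | h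
  · have hk : k ≠ i := h.ne'
    have key : ∀ b : ℕ → ℤ, (∀ j, j ≠ i → b j = a j) → (((∀ j < k, b j = 0) ∧ 0 < b k) ↔
        (b i = 0 ∧ (∀ j < k, j ≠ i → a j = 0) ∧ 0 < a k)) := by
      intro b hb
      rw [hb k hk]
      constructor
      · rintro ⟨h1, h2⟩
        exact ⟨h1 i h, fun j hj hji => by rw [← hb j hji, h1 j hj], h2⟩
      · rintro ⟨h1, h2, h3⟩
        refine ⟨fun j hj => ?_, h3⟩
        by_cases hji : j = i
        · rw [hji, h1]
        · rw [hb j hji, h2 j hj hji]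
    simp only [key u hadd, key w hsub, h.ne, h, if_false, true_and, hadd', hsub']
    by_cases hc : (∀ j < k, j ≠ i → a j = 0) ∧ 0 < a k
    · simp only [eq_true hc, and_true]
      by_cases h1 : a i = 1
      · rcases hs with rfl | rfl <;> simp [h1]
      · by_cases h2 : a i = -1
        · rcases hs with rfl | rfl <;> simp [h2]
        · rw [if_neg (by omega), if_neg (by omega), if_neg (by omega), sub_zero]
    · simp [hc]
  · have ha' := ha rfl
    have key : ∀ b : ℕ → ℤ, (∀ j, j ≠ i → b j = a j) → (((∀ j < i, b j = 0) ∧ 0 < b i) ↔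
        ((∀ j < i, a j = 0) ∧ 0 < b i)) := by
      intro b hb
      refine and_congr_left fun _ => forall₂_congr fun j hj => by rw [hb j hj.ne]
    have key2 : (∀ j < i + 1, a j = 0) ↔ (∀ j < i, a j = 0) ∧ a i = 0 := by
      constructor
      · exact fun h => ⟨fun j hj => h j (by omega), h i (by omega)⟩
      · rintro ⟨h1, h2⟩ j hj
        rcases (Nat.lt_succ_iff_lt_or_eq.1 hj) with h | rfl
        · exact h1 j h
        · exact h2
    simp only [key u hadd, key w hsub, if_true, key2]
    simp only [hadd', hsub']
    by_cases hc : ∀ j < i, a j = 0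
    · simp only [eq_true hc, true_and]
      obtain ⟨r, hr⟩ := ha'
      by_cases h0 : a i = 0
      · rcases hs with rfl | rfl <;> simp [h0]
      · by_cases h1 : 0 < a i
        · rw [if_pos (by omega), if_pos (by omega), if_neg h0, sub_self]
        · rw [if_neg (by omega), if_neg (by omega), if_neg h0, sub_self]
    · simp [hc]
  · have key : ∀ b : ℕ → ℤ, (∀ j, j ≠ i → b j = a j) → (((∀ j < k, b j = 0) ∧ 0 < b k) ↔
        ((∀ j < k, a j = 0) ∧ 0 < a k)) := by
      intro b hb
      rw [hb k h.ne]
      refine and_congr_left fun _ => forall₂_congr fun j hj => by rw [hb j (by omega)]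
    simp only [key u hadd, key w hsub, sub_self, h.ne', if_false, h.not_gt, false_and]

theorem positiveIndicator_sub_neg (k : ℕ) (a : ℕ → ℤ) (ha : a k ≠ 0) :
    positiveIndicator k a - positiveIndicator k (-a) = if ∀ j < k, a j = 0 then 1 else 0 := by
  have h01 : (0 : ZMod 2) - 1 = 1 := by decide
  unfold positiveIndicator
  have hneg : ∀ j, (-a) j = -a j := fun j => rfl
  simp only [hneg, neg_eq_zero]
  by_cases hc : ∀ j < k, a j = 0
  · simp only [eq_true hc, true_and, if_true]
    rcases lt_or_gt_of_ne ha with h | h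
    · rw [if_neg (by omega), if_pos (by omega), h01]
    · rw [if_pos (by omega), if_neg (by omega), sub_zero]
  · simp [hc]

end Parity

section Balanced

open Finset

variable {ι : Type*} [Fintype ι] {ℓ : ι → (ℕ → ℝ) →ₗ[ℝ] ℝ} {c : ι → ℕ} {K k : ℕ}

/-- The number of positive minus the number of negative values at `v` of the functionals of
colour `j`. -/
noncomputable def imbalance (ℓ : ι → (ℕ → ℝ) →ₗ[ℝ] ℝ) (c : ι → ℕ) (v : ℕ → ℝ) (j : ℕ) : ℤ :=
  ∑ y with c y = j, (SignType.sign (ℓ y v) : ℤ)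

omit [Fintype ι] in
theorem injective_of_forall_color_eq {e : Fin k → ι} (he : ∀ i, c (e i) = i) :
    Function.Injective e := fun i j h => Fin.ext (by rw [← he i, ← he j, h])

open Classical in
theorem sum_indicatorJump_node_snoc (hℓ : GeneralPosition ℓ K) (hk : k + 2 ≤ K)
    (hc : Odd (univ.filter fun y => c y = k).card) {e : Fin k → ι} (he : ∀ i, c (e i) = i) :
    ∑ x with x ∉ Set.range e,
        indicatorJump k (imbalance ℓ c (node ℓ (Fin.snoc e x : Fin (k + 1) → ι))) (c x) =
      if ∀ j < k, imbalance ℓ c (node ℓ e) j = 0 then 1 else 0 := by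
  have hinj := injective_of_forall_color_eq he
  have hb := hℓ.isNode_node (by omega) hinj
  set b := node ℓ e with hbdef
  set N : ι → ℕ → ℝ := fun x => node ℓ (Fin.snoc e x : Fin (k + 1) → ι) with hN
  have hsn : ∀ x, x ∉ Set.range e → Function.Injective (Fin.snoc e x : Fin (k + 1) → ι) :=
    fun x hx => Fin.snoc_injective_iff.2 ⟨hinj, hx⟩
  have hNode : ∀ x, x ∉ Set.range e → IsNode ℓ (Fin.snoc e x : Fin (k + 1) → ι) (N x) :=
    fun x hx => hℓ.isNode_node (by omega) (hsn x hx)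
  have hrange : ∀ y ∈ Set.range e, c y < k := by
    rintro _ ⟨i, rfl⟩
    rw [he]; exact i.2
  have hbe : ∀ y ∈ Set.range e, ℓ y b = 0 := by
    rintro _ ⟨i, rfl⟩
    exact hb.2.2 i
  have hbne : ∀ y, y ∉ Set.range e → ℓ y b ≠ 0 := fun y hy =>
    hb.apply_ne_zero hℓ (by omega) hinj hy
  have hval : ∀ x y, x ∉ Set.range e → y ∉ Set.range e →
      ℓ y (N x) = (N x k - N y k) * ℓ y b := by
    intro x y hx hy
    have h1 := congrArg (ℓ y) (node_snoc_sub_node_snoc hℓ (by omega) hinj hx hy)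
    have h2 : ℓ y (N y) = 0 := by simpa using (hNode y hy).2.2 (Fin.last k)
    rw [map_sub, map_smul, smul_eq_mul] at h1
    change ℓ y (N x) - ℓ y (N y) = (N x k - N y k) * ℓ y b at h1
    rw [← h1, h2, sub_zero]
  have hNe : ∀ x, x ∉ Set.range e → ∀ y ∈ Set.range e, ℓ y (N x) = 0 := by
    rintro x hx _ ⟨i, rfl⟩
    simpa using (hNode x hx).2.2 i.castSucc
  have hNne : ∀ x, x ∉ Set.range e → ∀ y, y ∉ Set.range e → y ≠ x → ℓ y (N x) ≠ 0 := by
    intro x hx y hy hyx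
    refine (hNode x hx).apply_ne_zero hℓ (by omega) (hsn x hx) ?_
    rintro ⟨i, hi⟩
    revert hi
    refine Fin.lastCases ?_ (fun i => ?_) i
    · simpa using hyx.symm
    · simpa using fun h => hy ⟨i, h⟩
  set X : Finset ι := {x | x ∉ Set.range e} with hX
  have hXm : ∀ x, x ∈ X ↔ x ∉ Set.range e := fun x => by simp [hX]
  set B : Finset ι → ℕ → ℤ := fun U j => ∑ y with c y = j,
    (if y ∈ U then (SignType.sign (ℓ y b) : ℤ) else -(SignType.sign (ℓ y b) : ℤ)) with hB
  have htinj : Set.InjOn (fun x => N x k) X := by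
    intro x hx y hy hxy
    rw [mem_coe, hXm] at hx hy
    by_contra hne
    apply hNne x hx y hy (Ne.symm hne)
    have hxy' : N x k = N y k := hxy
    rw [hval x y hx hy, hxy', sub_self, zero_mul]
  have htel := sum_sublevel_sub_sublevel (fun x => N x k) (fun U => positiveIndicator k (B U)) X
    htinj
  have hBX : B X = imbalance ℓ c b := by
    ext j
    refine sum_congr rfl fun y _ => ?_
    by_cases hy : y ∈ X
    · rw [if_pos hy]
    · rw [if_neg hy, hbe y (by simpa [hXm] using hy)]; simp
  have hB0 : B ∅ = -imbalance ℓ c b := by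
    ext j
    simp [hB, imbalance]
  have hbk : imbalance ℓ c b k ≠ 0 := by
    have : Odd (imbalance ℓ c b k) := by
      unfold imbalance
      rw [odd_sum_sign_iff, filter_true_of_mem]
      · exact hc
      · intro y hy
        apply hbne
        intro hy'
        have := hrange y hy'
        simp only [mem_filter] at hy
        omega
    intro h
    rw [h] at this
    exact absurd this (by decide)
  rw [hBX, hB0, positiveIndicator_sub_neg _ _ hbk] at htel
  rw [← htel]
  refine sum_congr rfl fun x hx => ?_
  rw [hXm] at hx
  have hsx : (SignType.sign (ℓ x b) : ℤ) = 1 ∨ (SignType.sign (ℓ x b) : ℤ) = -1 := by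
    rcases lt_or_gt_of_ne (hbne x hx) with h | h
    · right; rw [sign_neg h]; rfl
    · left; rw [sign_pos h]; rfl
  have hx0 : ℓ x (N x) = 0 := by rw [hval x x hx hx]; simp
  have hsingle : ∀ j, (Pi.single (c x) (SignType.sign (ℓ x b) : ℤ) : ℕ → ℤ) j =
      ∑ y with c y = j, if y = x then (SignType.sign (ℓ x b) : ℤ) else 0 := by
    intro j
    rw [sum_ite_eq']
    by_cases h : c x = j
    · subst h; simp
    · rw [Pi.single_eq_of_ne (Ne.symm h), if_neg (by simpa using h)]
  have hoff : ∀ y, y ≠ x → (SignType.sign (ℓ y (N x)) : ℤ) =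
      if y ∈ X ∧ N y k < N x k then (SignType.sign (ℓ y b) : ℤ)
        else -(SignType.sign (ℓ y b) : ℤ) := by
    intro y hyx
    by_cases hy : y ∈ Set.range e
    · rw [hNe x hx y hy, hbe y hy]; simp
    · rw [hval x y hx hy, sign_mul]
      have hyX : y ∈ X := (hXm y).2 hy
      rcases lt_trichotomy (N y k) (N x k) with h | h | h
      · rw [if_pos ⟨hyX, h⟩, sign_pos (by linarith)]; simp
      · exact absurd (htinj (by simpa using hyX) (by simpa [hXm] using hx) h) hyx
      · rw [if_neg (fun h' => h'.2.not_gt h), sign_neg (by linarith)]; simp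
  have hle : B {y ∈ X | N y k ≤ N x k} =
      imbalance ℓ c (N x) + Pi.single (c x) (SignType.sign (ℓ x b) : ℤ) := by
    ext j
    rw [Pi.add_apply, hsingle, imbalance, ← sum_add_distrib]
    refine sum_congr rfl fun y _ => ?_
    by_cases hyx : y = x
    · subst hyx
      simp [hx0, (hXm y).2 hx]
    · rw [hoff y hyx, if_neg hyx, add_zero]
      have : (y ∈ ({y ∈ X | N y k ≤ N x k} : Finset ι)) ↔ (y ∈ X ∧ N y k < N x k) := by
        rw [mem_filter]
        refine and_congr_right fun hy => ⟨fun h => lt_of_le_of_ne h fun h' => hyx ?_, le_of_lt⟩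
        exact htinj (by simpa using hy) (by simpa [hXm] using hx) h'
      simp only [this]
  have hlt : B {y ∈ X | N y k < N x k} =
      imbalance ℓ c (N x) - Pi.single (c x) (SignType.sign (ℓ x b) : ℤ) := by
    ext j
    rw [Pi.sub_apply, hsingle, imbalance, ← sum_sub_distrib]
    refine sum_congr rfl fun y _ => ?_
    by_cases hyx : y = x
    · subst hyx
      simp [hx0]
    · rw [hoff y hyx, if_neg hyx, sub_zero]
      simp only [mem_filter]
  rw [hle, hlt, positiveIndicator_add_sub _ _ _ _ hsx]
  intro hcx
  rw [← Int.not_odd_iff_even, imbalance, odd_sum_sign_iff]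
  have : ({y ∈ ({y | c y = k} : Finset ι) | ℓ y (N x) ≠ 0}) =
      (({y | c y = k} : Finset ι)).erase x := by
    ext y
    simp only [mem_filter, mem_univ, true_and, mem_erase]
    constructor
    · rintro ⟨h1, h2⟩
      exact ⟨fun h => h2 (h ▸ hx0), h1⟩
    · rintro ⟨h1, h2⟩
      exact ⟨h2, hNne x hx y (fun h => by have := hrange y h; omega) h1⟩
  rw [this, card_erase_of_mem (by simpa using hcx), Nat.not_odd_iff_even]
  exact Nat.Odd.sub_odd hc odd_one

end Balanced

section HamSandwich

open Finset

variable {ι : Type*} [Fintype ι] {ℓ : ι → (ℕ → ℝ) →ₗ[ℝ] ℝ} {c : ι → ℕ} {K k : ℕ}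

omit [Fintype ι] in
/-- Exchanging the last functional with another one does not change the node. -/
theorem node_snoc_update (hℓ : GeneralPosition ℓ K) (hk : k + 1 ≤ K) {e : Fin k → ι}
    (he : Function.Injective e) {x : ι} (hx : x ∉ Set.range e) (i : Fin k) :
    node ℓ (Fin.snoc (Function.update e i x) (e i) : Fin (k + 1) → ι) =
      node ℓ (Fin.snoc e x : Fin (k + 1) → ι) := by
  have hx' : ∀ j, e j ≠ x := fun j h => hx ⟨j, h⟩
  have he' : Function.Injective (Function.update e i x) := by
    intro a b hab
    by_cases ha : a = i <;> by_cases hb : b = i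
    · rw [ha, hb]
    · subst ha
      rw [Function.update_self, Function.update_of_ne hb] at hab
      exact absurd hab.symm (hx' b)
    · subst hb
      rw [Function.update_self, Function.update_of_ne ha] at hab
      exact absurd hab (hx' a)
    · rw [Function.update_of_ne ha, Function.update_of_ne hb] at hab
      exact he hab
  have hi : e i ∉ Set.range (Function.update e i x) := by
    rintro ⟨j, hj⟩
    by_cases h : j = i
    · subst h
      rw [Function.update_self] at hj
      exact hx' j hj.symm
    · rw [Function.update_of_ne h] at hj
      exact h (he hj)
  have h1 : Function.Injective (Fin.snoc e x : Fin (k + 1) → ι) :=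
    Fin.snoc_injective_iff.2 ⟨he, hx⟩
  have h2 : Function.Injective (Fin.snoc (Function.update e i x) (e i) : Fin (k + 1) → ι) :=
    Fin.snoc_injective_iff.2 ⟨he', hi⟩
  have n1 := hℓ.isNode_node hk h1
  have n2 := hℓ.isNode_node hk h2
  refine n2.eq_of_annihilates hℓ hk h2 n1 fun j => ?_
  refine Fin.lastCases ?_ (fun j => ?_) j
  · simpa using n1.2.2 i.castSucc
  · rw [Fin.snoc_castSucc]
    by_cases h : j = i
    · subst h
      rw [Function.update_self]
      simpa using n1.2.2 (Fin.last k)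
    · rw [Function.update_of_ne h]
      simpa using n1.2.2 j.castSucc

open Classical in
/-- The number of nodes of transversals of the colours below `k` that bisect each of these
colours. -/
noncomputable def bisectingCount (ℓ : ι → (ℕ → ℝ) →ₗ[ℝ] ℝ) (c : ι → ℕ) (k : ℕ) : ℕ :=
  (univ.filter fun e : Fin k → ι =>
    (∀ i, c (e i) = i) ∧ ∀ j < k, imbalance ℓ c (node ℓ e) j = 0).card

open Classical in
theorem bisectingCount_succ (hℓ : GeneralPosition ℓ K) (hk : k + 2 ≤ K)
    (hc : Odd (univ.filter fun y => c y = k).card) :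
    (bisectingCount ℓ c (k + 1) : ZMod 2) = bisectingCount ℓ c k := by
  let N : (Fin k → ι) → ι → ℕ → ℝ := fun e x => node ℓ (Fin.snoc e x : Fin (k + 1) → ι)
  let P : Finset ((Fin k → ι) × ι) := {q | (∀ i, c (q.1 i) = i) ∧ q.2 ∉ Set.range q.1}
  let f : (Fin k → ι) × ι → ZMod 2 := fun q =>
    indicatorJump k (imbalance ℓ c (N q.1 q.2)) (c q.2)
  have h1 : (bisectingCount ℓ c k : ZMod 2) = ∑ q ∈ P, f q := by
    have : (bisectingCount ℓ c k : ZMod 2) = ∑ e : Fin k → ι with ∀ i : Fin k, c (e i) = i,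
        ∑ x with x ∉ Set.range e, f (e, x) := by
      rw [bisectingCount, ← filter_filter, card_filter, Nat.cast_sum]
      refine sum_congr rfl fun e he => ?_
      rw [sum_indicatorJump_node_snoc hℓ hk hc (by simpa using he)]
      simp
    rw [this, sum_sigma']
    refine sum_nbij' (fun s => (s.1, s.2)) (fun q => ⟨q.1, q.2⟩) ?_ ?_ ?_ ?_ ?_ <;> simp [P]
  have h2 : ∑ q ∈ P with c q.2 ≠ k, f q = 0 := by
    have hf : ∀ q : (Fin k → ι) × ι, c q.2 ≠ k → f q ≠ 0 → c q.2 < k := by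
      intro q hq h
      by_contra hlt
      apply h
      simp only [f, indicatorJump]
      rw [if_neg hq, if_neg fun h => hlt h.1]
    let g : (Fin k → ι) × ι → (Fin k → ι) × ι := fun q =>
      if h : c q.2 < k then (Function.update q.1 ⟨c q.2, h⟩ q.2, q.1 ⟨c q.2, h⟩) else q
    have hg : ∀ q (h : c q.2 < k),
        g q = (Function.update q.1 ⟨c q.2, h⟩ q.2, q.1 ⟨c q.2, h⟩) := fun q h => dif_pos h
    have hg' : ∀ q, ¬ c q.2 < k → g q = q := fun q h => dif_neg h
    refine sum_involution (fun q _ => g q) ?_ ?_ ?_ ?_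
    · intro q hq
      simp only [P, mem_filter, mem_univ, true_and] at hq
      suffices h : f (g q) = f q by rw [h, CharTwo.add_self_eq_zero]
      by_cases h : c q.2 < k
      · rw [hg q h]
        simp only [f, N]
        rw [node_snoc_update hℓ (by omega) (injective_of_forall_color_eq hq.1.1) hq.1.2,
          hq.1.1]
      · rw [hg' q h]
    · intro q hq hfq hgq
      simp only [P, mem_filter, mem_univ, true_and] at hq
      rw [hg q (hf q hq.2 hfq)] at hgq
      exact hq.1.2 ⟨_, congrArg Prod.snd hgq⟩
    · intro q hq
      by_cases h : c q.2 < k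
      · rw [hg q h]
        simp only [P, mem_filter, mem_univ, true_and] at hq ⊢
        refine ⟨⟨fun i => ?_, ?_⟩, ?_⟩
        · by_cases hi : i = ⟨c q.2, h⟩
          · subst hi
            rw [Function.update_self]
          · rw [Function.update_of_ne hi, hq.1.1]
        · rintro ⟨j, hj⟩
          by_cases hi : j = ⟨c q.2, h⟩
          · subst hi
            rw [Function.update_self] at hj
            exact hq.1.2 ⟨_, hj.symm⟩
          · rw [Function.update_of_ne hi] at hj
            exact hi (injective_of_forall_color_eq hq.1.1 hj)
        · rw [hq.1.1]
          exact h.ne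
      · rwa [hg' q h]
    · intro q hq
      simp only [P, mem_filter, mem_univ, true_and] at hq
      by_cases h : c q.2 < k
      · have h' : c (q.1 ⟨c q.2, h⟩) = c q.2 := hq.1.1 _
        have h3 : c (g q).2 < k := by rw [hg q h]; exact h'.trans_lt h
        have h4 : (⟨c (g q).2, h3⟩ : Fin k) = ⟨c q.2, h⟩ := by
          apply Fin.ext
          simp only [hg q h, h']
        rw [hg (g q) h3, h4, hg q h]
        simp
      · rw [hg' q h, hg' q h]
  have h3 : ∑ q ∈ P with c q.2 = k, f q = bisectingCount ℓ c (k + 1) := by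
    rw [bisectingCount, ← filter_filter, card_filter, Nat.cast_sum]
    refine sum_nbij' (fun q => (Fin.snoc q.1 q.2 : Fin (k + 1) → ι))
      (fun e => (fun i => e i.castSucc, e (Fin.last k))) ?_ ?_ ?_ ?_ ?_
    · rintro ⟨e, x⟩ h
      simp only [P, mem_filter, mem_univ, true_and] at h ⊢
      intro i
      refine Fin.lastCases ?_ (fun i => ?_) i
      · simpa using h.2
      · simpa using h.1.1 i
    · intro e h
      simp only [P, mem_filter, mem_univ, true_and] at h ⊢
      refine ⟨⟨fun i => by simpa using h i.castSucc, ?_⟩, by simpa using h (Fin.last k)⟩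
      rintro ⟨i, hi⟩
      have := injective_of_forall_color_eq h hi
      exact absurd this (Fin.castSucc_lt_last i).ne
    · rintro ⟨e, x⟩ _
      simp
    · intro e _
      exact Fin.snoc_init_self e
    · rintro ⟨e, x⟩ h
      simp only [mem_filter] at h
      simp [f, indicatorJump, h.2, N]
  rw [h1, ← h3, ← sum_filter_add_sum_filter_not P (fun q => c q.2 = k), h2, add_zero]

theorem odd_bisectingCount (hℓ : GeneralPosition ℓ K)
    (hc : ∀ j, j + 2 ≤ K → Odd (univ.filter fun y => c y = j).card) (hk : k + 1 ≤ K) :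
    Odd (bisectingCount ℓ c k) := by
  rw [← ZMod.natCast_eq_one_iff_odd]
  induction k with
  | zero => simp [bisectingCount]
  | succ k ih => rw [bisectingCount_succ hℓ hk (hc k hk), ih (by omega)]

/-- **Ham sandwich theorem**, for odd colour classes in general position. -/
theorem GeneralPosition.exists_bisecting {N : ℕ} (hℓ : GeneralPosition ℓ (N + 1))
    (hc : ∀ j < N, Odd (univ.filter fun y => c y = j).card) :
    ∃ v : ℕ → ℝ, v N = 1 ∧ ∀ j < N, imbalance ℓ c v j = 0 := by
  classical
  have h := (odd_bisectingCount hℓ (fun j hj => hc j (by omega)) le_rfl).pos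
  obtain ⟨e, he⟩ := card_pos.1 h
  simp only [mem_filter, mem_univ, true_and] at he
  exact ⟨node ℓ e, (hℓ.isNode_node (by omega) (injective_of_forall_color_eq he.1)).1, he.2⟩

end HamSandwich

section Perturbation

open Finset Filter Topology

theorem sum_sign_eq_card_sub_card {ι : Type*} (s : Finset ι) (f : ι → ℝ) :
    ∑ y ∈ s, (SignType.sign (f y) : ℤ) =
      (s.filter fun y => 0 < f y).card - (s.filter fun y => f y < 0).card := by
  rw [card_filter, card_filter, Nat.cast_sum, Nat.cast_sum, ← sum_sub_distrib]
  refine sum_congr rfl fun y _ => ?_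
  rcases lt_trichotomy (f y) 0 with h | h | h
  · simp [h, h.not_gt]
  · simp [h]
  · simp [h, h.not_gt]

variable {ι : Type*} [Fintype ι]

theorem two_mul_card_le_of_imbalance_eq_zero {ℓ : ι → (ℕ → ℝ) →ₗ[ℝ] ℝ} {c : ι → ℕ} {v : ℕ → ℝ}
    {j : ℕ} (h : imbalance ℓ c v j = 0) :
    2 * (univ.filter fun y => c y = j ∧ 0 < ℓ y v).card ≤ (univ.filter fun y => c y = j).card ∧
    2 * (univ.filter fun y => c y = j ∧ ℓ y v < 0).card ≤ (univ.filter fun y => c y = j).card := by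
  classical
  rw [imbalance, sum_sign_eq_card_sub_card, filter_filter, filter_filter] at h
  have hdisj : Disjoint (univ.filter fun y => c y = j ∧ 0 < ℓ y v)
      (univ.filter fun y => c y = j ∧ ℓ y v < 0) := by
    rw [disjoint_left]
    intro y h1 h2
    simp only [mem_filter] at h1 h2
    exact h1.2.2.not_gt h2.2.2
  have hle : ((univ.filter fun y => c y = j ∧ 0 < ℓ y v) ∪
      (univ.filter fun y => c y = j ∧ ℓ y v < 0)).card ≤ (univ.filter fun y => c y = j).card := by
    refine card_le_card fun y hy => ?_
    simp only [mem_union, mem_filter] at hy ⊢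
    rcases hy with hy | hy <;> exact ⟨mem_univ _, hy.2.1⟩
  rw [card_union_of_disjoint hdisj] at hle
  omega

/-- The functional with coefficients `p j` for `j < K`. -/
def truncatedDot (K : ℕ) (p : ℕ → ℝ) : (ℕ → ℝ) →ₗ[ℝ] ℝ :=
  ∑ j ∈ range K, p j • LinearMap.proj j

theorem truncatedDot_apply (K : ℕ) (p v : ℕ → ℝ) :
    truncatedDot K p v = ∑ j ∈ range K, p j * v j := by
  simp [truncatedDot]

omit [Fintype ι] in
theorem generalPosition_of_det_ne_zero {K : ℕ} {p : ι → ℕ → ℝ}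
    (h : ∀ m ≤ K, ∀ x : Fin m → ι, Function.Injective x →
      (Matrix.of fun i j : Fin m => p (x i) j).det ≠ 0) :
    GeneralPosition (fun y => truncatedDot K (p y)) K := by
  intro m hm x hx v hv h0
  have hmul : (Matrix.of fun i j : Fin m => p (x i) j).mulVec (fun j => v j) = 0 := by
    ext i
    rw [Pi.zero_apply, ← h0 i, truncatedDot_apply, Matrix.mulVec, dotProduct,
      ← sum_subset (range_subset_range.2 hm), sum_range]
    · rfl
    · intro j _ hj
      rw [hv j (by simpa using hj), mul_zero]
  have := Matrix.eq_zero_of_mulVec_eq_zero (h m hm x hx) hmul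
  ext j
  by_cases hj : j < m
  · exact congrFun this ⟨j, hj⟩
  · exact hv j (by omega)

theorem eventually_det_add_smul_ne_zero {m : ℕ} (A B : Matrix (Fin m) (Fin m) ℝ)
    (hB : B.det ≠ 0) : ∀ᶠ ε in 𝓝[≠] (0 : ℝ), (A + ε • B).det ≠ 0 := by
  let P : Polynomial ℝ :=
    ((Polynomial.X : Polynomial ℝ) • B.map Polynomial.C + A.map Polynomial.C).det
  have hP : P ≠ 0 := by
    intro h
    have := Polynomial.coeff_det_X_add_C_card B A
    change P.coeff _ = _ at this
    exact hB (by rw [← this, h, Polynomial.coeff_zero])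
  have hev : ∀ ε, P.eval ε = (A + ε • B).det := by
    intro ε
    have h := RingHom.map_det (Polynomial.evalRingHom ε)
      ((Polynomial.X : Polynomial ℝ) • B.map Polynomial.C + A.map Polynomial.C)
    rw [Polynomial.coe_evalRingHom] at h
    rw [h]
    congr 1
    ext i j
    simp [add_comm]
    exact mul_comm _ _
  have hfin : {ε | P.eval ε = 0}.Finite := by
    refine P.roots.toFinset.finite_toSet.subset fun ε hε => ?_
    simpa [hP] using hε
  have hcl : IsClosed ({ε | P.eval ε = 0} \ {0}) := (hfin.subset Set.sdiff_subset).isClosed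
  rw [eventually_nhdsWithin_iff]
  filter_upwards [hcl.isOpen_compl.mem_nhds (by simp)] with ε hε hε0 h
  exact hε ⟨(hev ε).trans h, hε0⟩

theorem exists_perturbation_generalPosition (K : ℕ) (p : ι → ℕ → ℝ) :
    ∃ r : ι → ℕ → ℝ, ∀ᶠ ε in 𝓝[≠] (0 : ℝ),
      GeneralPosition (fun y => truncatedDot K (p y + ε • r y)) K := by
  let τ : ι → ℝ := fun y => (Fintype.equivFin ι y : ℕ)
  have hτ : Function.Injective τ := fun a b h => by simpa [τ, Fin.val_inj] using h
  refine ⟨fun y j => τ y ^ j, ?_⟩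
  have : ∀ᶠ ε in 𝓝[≠] (0 : ℝ), ∀ m : Fin (K + 1), ∀ x : Fin m → ι, Function.Injective x →
      ((Matrix.of fun i j : Fin m => p (x i) j) +
        ε • Matrix.vandermonde fun i => τ (x i)).det ≠ 0 := by
    refine eventually_all.2 fun m => eventually_all.2 fun x => ?_
    by_cases hx : Function.Injective x
    · filter_upwards [eventually_det_add_smul_ne_zero (Matrix.of fun i j : Fin m => p (x i) j) _
        (Matrix.det_vandermonde_ne_zero_iff.2 (hτ.comp hx))] with ε hε _
      exact hε
    · simp [hx]
  filter_upwards [this] with ε hε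
  refine generalPosition_of_det_ne_zero fun m hm x hx => ?_
  convert hε ⟨m, by omega⟩ x hx using 2
  ext i j
  simp [Matrix.vandermonde]

/-- **Ham sandwich theorem** for odd colour classes. -/
theorem exists_halving_of_odd (N : ℕ) (c : ι → ℕ) (p : ι → ℕ → ℝ)
    (hc : ∀ j < N, Odd (univ.filter fun y => c y = j).card) :
    ∃ w : Fin (N + 1) → ℝ, w ≠ 0 ∧ ∀ j < N,
      2 * (univ.filter fun y => c y = j ∧ 0 < ∑ i : Fin (N + 1), p y i * w i).card ≤
        (univ.filter fun y => c y = j).card ∧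
      2 * (univ.filter fun y => c y = j ∧ ∑ i : Fin (N + 1), p y i * w i < 0).card ≤
        (univ.filter fun y => c y = j).card := by
  obtain ⟨r, hr⟩ := exists_perturbation_generalPosition (N + 1) p
  have key : ∀ᶠ ε in 𝓝[≠] (0 : ℝ), ∃ w ∈ Metric.sphere (0 : Fin (N + 1) → ℝ) 1, ∀ j < N,
      2 * (univ.filter fun y => c y = j ∧ 0 < ∑ i : Fin (N + 1), (p y i + ε * r y i) * w i).card ≤
        (univ.filter fun y => c y = j).card ∧
      2 * (univ.filter fun y => c y = j ∧ ∑ i : Fin (N + 1), (p y i + ε * r y i) * w i < 0).card ≤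
        (univ.filter fun y => c y = j).card := by
    filter_upwards [hr] with ε hε
    obtain ⟨v, hv1, hv⟩ := hε.exists_bisecting hc
    let u : Fin (N + 1) → ℝ := fun i => v i
    have hu : u ≠ 0 := fun h => by simpa [u, hv1] using congrFun h (Fin.last N)
    have hu' : 0 < ‖u‖⁻¹ := inv_pos.2 (norm_pos_iff.2 hu)
    refine ⟨‖u‖⁻¹ • u, by simp [norm_smul, hu], fun j hj => ?_⟩
    have hsum : ∀ y, ∑ i : Fin (N + 1), (p y i + ε * r y i) * (‖u‖⁻¹ • u) i =
        ‖u‖⁻¹ * truncatedDot (N + 1) (p y + ε • r y) v := by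
      intro y
      rw [truncatedDot_apply, sum_range, mul_sum]
      refine sum_congr rfl fun i _ => ?_
      simp only [Pi.smul_apply, Pi.add_apply, smul_eq_mul, u]
      ring
    have hneg : ∀ t : ℝ, ‖u‖⁻¹ * t < 0 ↔ t < 0 := fun t => by
      rw [mul_neg_iff]
      simp [hu'.not_gt, hu]
    simp only [hsum, mul_pos_iff_of_pos_left hu', hneg]
    exact two_mul_card_le_of_imbalance_eq_zero (hv j hj)
  rw [eventually_iff_exists_mem] at key
  obtain ⟨s, hs, key⟩ := key
  choose! w hw using key
  let U : Ultrafilter ℝ := Ultrafilter.of (𝓝[≠] (0 : ℝ))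
  have hU : (U : Filter ℝ) ≤ 𝓝[≠] 0 := Ultrafilter.of_le _
  have hwU : ∀ᶠ ε in (U : Filter ℝ), ε ∈ s := hU hs
  obtain ⟨a, ha, hlim⟩ := (isCompact_sphere (0 : Fin (N + 1) → ℝ) 1).ultrafilter_le_nhds
    (U.map w) (by
      rw [le_principal_iff]
      exact hwU.mono fun ε hε => (hw ε hε).1)
  have hlim : Tendsto w U (𝓝 a) := hlim
  have hid : Tendsto (fun ε : ℝ => ε) U (𝓝 0) := hU.trans nhdsWithin_le_nhds
  have hsum : ∀ y, Tendsto (fun ε => ∑ i : Fin (N + 1), (p y i + ε * r y i) * w ε i) U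
      (𝓝 (∑ i : Fin (N + 1), p y i * a i)) := by
    intro y
    refine tendsto_finsetSum _ fun i _ => ?_
    have h1 : Tendsto (fun ε => p y i + ε * r y i) U (𝓝 (p y i + 0 * r y i)) :=
      tendsto_const_nhds.add (hid.mul_const _)
    rw [zero_mul, add_zero] at h1
    exact h1.mul ((continuous_apply i).tendsto a |>.comp hlim)
  have hpos : ∀ᶠ ε in (U : Filter ℝ), ∀ y, 0 < ∑ i : Fin (N + 1), p y i * a i →
      0 < ∑ i : Fin (N + 1), (p y i + ε * r y i) * w ε i :=
    eventually_all.2 fun y => eventually_imp_distrib_left.2 fun h => (hsum y).eventually_const_lt h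
  have hneg : ∀ᶠ ε in (U : Filter ℝ), ∀ y, ∑ i : Fin (N + 1), p y i * a i < 0 →
      ∑ i : Fin (N + 1), (p y i + ε * r y i) * w ε i < 0 :=
    eventually_all.2 fun y => eventually_imp_distrib_left.2 fun h => (hsum y).eventually_lt_const h
  obtain ⟨ε, h1, h2, h3⟩ := (hwU.and (hpos.and hneg)).exists
  refine ⟨a, fun h => by simp [h] at ha, fun j hj => ⟨?_, ?_⟩⟩
  · refine le_trans (Nat.mul_le_mul_left 2 (card_le_card fun y hy => ?_)) ((hw ε h1).2 j hj).1
    simp only [mem_filter] at hy ⊢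
    exact ⟨hy.1, hy.2.1, h2 y hy.2.2⟩
  · refine le_trans (Nat.mul_le_mul_left 2 (card_le_card fun y hy => ?_)) ((hw ε h1).2 j hj).2
    simp only [mem_filter] at hy ⊢
    exact ⟨hy.1, hy.2.1, h3 y hy.2.2⟩

/-- **Ham sandwich theorem**, discrete version: any `N` finite colour classes of vectors in
`ℝ ^ (N + 1)` are simultaneously halved by a hyperplane through the origin. -/
theorem exists_halving (N : ℕ) (c : ι → ℕ) (p : ι → ℕ → ℝ) :
    ∃ w : Fin (N + 1) → ℝ, w ≠ 0 ∧ ∀ j < N,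
      2 * (univ.filter fun y => c y = j ∧ 0 < ∑ i : Fin (N + 1), p y i * w i).card ≤
        (univ.filter fun y => c y = j).card ∧
      2 * (univ.filter fun y => c y = j ∧ ∑ i : Fin (N + 1), p y i * w i < 0).card ≤
        (univ.filter fun y => c y = j).card := by
  classical
  let d : Fin N → ℕ := fun i => if Even (univ.filter fun y => c y = i).card then i else N
  have hd : ∀ j (hj : j < N), (univ.filter fun i => d i = j).card =
      if Even (univ.filter fun y => c y = j).card then 1 else 0 := by
    intro j hj
    split_ifs with h
    · rw [card_eq_one]
      refine ⟨⟨j, hj⟩, ?_⟩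
      ext i
      simp only [mem_filter, mem_univ, true_and, mem_singleton, d]
      constructor
      · intro hi
        split_ifs at hi with h'
        · exact Fin.ext hi
        · omega
      · rintro rfl
        rw [if_pos h]
    · rw [card_eq_zero, filter_eq_empty_iff]
      intro i _ hi
      simp only [d] at hi
      split_ifs at hi with h'
      · exact h (hi ▸ h')
      · omega
  have hcard : ∀ j < N, (univ.filter fun y => Sum.elim c d y = j).card =
      (univ.filter fun y => c y = j).card +
        if Even (univ.filter fun y => c y = j).card then 1 else 0 := by
    intro j hj
    rw [← hd j hj]
    simp only [card_filter, Fintype.sum_sum_type, Sum.elim_inl, Sum.elim_inr]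
    congr! 1
  obtain ⟨w, hw0, hw⟩ := exists_halving_of_odd N (Sum.elim c d) (Sum.elim p 0) (by
    intro j hj
    rw [hcard j hj]
    split_ifs with h
    · exact h.add_one
    · simpa using h)
  refine ⟨w, hw0, fun j hj => ?_⟩
  obtain ⟨h1, h2⟩ := hw j hj
  rw [hcard j hj] at h1 h2
  have h3 : (univ.filter fun y => c y = j ∧ 0 < ∑ i : Fin (N + 1), p y i * w i).card ≤
      (univ.filter fun y => Sum.elim c d y = j ∧
        0 < ∑ i : Fin (N + 1), (Sum.elim p 0 : ι ⊕ Fin N → ℕ → ℝ) y i * w i).card := by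
    refine card_le_card_of_injOn Sum.inl (fun y hy => ?_) Sum.inl_injective.injOn
    simpa using hy
  have h4 : (univ.filter fun y => c y = j ∧ ∑ i : Fin (N + 1), p y i * w i < 0).card ≤
      (univ.filter fun y => Sum.elim c d y = j ∧
        ∑ i : Fin (N + 1), (Sum.elim p 0 : ι ⊕ Fin N → ℕ → ℝ) y i * w i < 0).card := by
    refine card_le_card_of_injOn Sum.inl (fun y hy => ?_) Sum.inl_injective.injOn
    simpa using hy
  split_ifs at h1 h2 with h
  · obtain ⟨s, hs⟩ := h
    constructor <;> omega
  · constructor <;> omega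

end Perturbation

section CellDecomposition

open Finset

/-- **Polynomial ham sandwich theorem.** -/
theorem exists_polynomial_halving {ι : Type*} [Fintype ι] (n m N : ℕ) (hN : N < (m + 1) ^ n)
    (c : ι → ℕ) (q : ι → Fin n → ℝ) :
    ∃ P : MvPolynomial (Fin n) ℝ, P ≠ 0 ∧ P.totalDegree ≤ n * m ∧ ∀ j < N,
      2 * (univ.filter fun y => c y = j ∧ 0 < MvPolynomial.eval (q y) P).card ≤
        (univ.filter fun y => c y = j).card ∧
      2 * (univ.filter fun y => c y = j ∧ MvPolynomial.eval (q y) P < 0).card ≤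
        (univ.filter fun y => c y = j).card := by
  obtain ⟨s⟩ : Nonempty (Fin (N + 1) ↪ (Fin n → Fin (m + 1))) :=
    Function.Embedding.nonempty_of_card_le (by simpa using hN)
  let σ : Fin (N + 1) → (Fin n →₀ ℕ) := fun j =>
    Finsupp.equivFunOnFinite.symm fun i => (s j i : ℕ)
  have hσ : Function.Injective σ := by
    intro a b hab
    apply s.injective
    ext i
    exact DFunLike.congr_fun hab i
  obtain ⟨w, hw0, hw⟩ := exists_halving N c fun y j =>
    if h : j < N + 1 then ∏ i, q y i ^ (s ⟨j, h⟩ i : ℕ) else 0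
  let P : MvPolynomial (Fin n) ℝ := ∑ j, MvPolynomial.monomial (σ j) (w j)
  have hP : ∀ j, P.coeff (σ j) = w j := by
    intro j
    simp only [P, MvPolynomial.coeff_sum, MvPolynomial.coeff_monomial, hσ.eq_iff]
    simp
  have hev : ∀ y, MvPolynomial.eval (q y) P = ∑ j : Fin (N + 1),
      (if h : (j : ℕ) < N + 1 then ∏ i, q y i ^ (s ⟨j, h⟩ i : ℕ) else 0) * w j := by
    intro y
    simp only [P, map_sum, MvPolynomial.eval_monomial]
    refine sum_congr rfl fun j _ => ?_
    rw [dif_pos j.2, mul_comm, Finsupp.prod_fintype _ _ (by simp)]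
    rfl
  refine ⟨P, fun h => hw0 ?_, ?_, ?_⟩
  · ext j
    rw [← hP j, h]
    simp
  · refine MvPolynomial.totalDegree_finsetSum_le fun j _ => ?_
    refine (MvPolynomial.totalDegree_monomial_le _ _).trans ?_
    rw [Finsupp.sum_fintype _ _ (by simp)]
    calc ∑ i, σ j i ≤ ∑ _i : Fin n, m := sum_le_sum fun i _ => Nat.lt_succ_iff.1 (s j i).2
      _ = n * m := by simp
  · simpa only [hev] using hw

/-- The zero set of `P` cuts its complement into `M` cells, bounded by the zero set, each
containing at most a proportion `1 / M` of the finite set `E`. -/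
def HasCellDecomposition {n : ℕ} (E : Finset (Fin n → ℝ)) (M : ℕ)
    (P : MvPolynomial (Fin n) ℝ) : Prop :=
  ∃ Ω : Fin M → Set (Fin n → ℝ),
    (Pairwise fun i j => Disjoint (Ω i) (Ω j)) ∧
    (Set.univ : Set (Fin n → ℝ)) = {x | MvPolynomial.eval x P = 0} ∪ ⋃ i, Ω i ∧
    (∀ i, frontier (Ω i) ⊆ {x | MvPolynomial.eval x P = 0}) ∧
    (∀ i, M * ((E : Set (Fin n → ℝ)) ∩ Ω i).ncard ≤ E.card)

theorem hasCellDecomposition_one {n : ℕ} (E : Finset (Fin n → ℝ)) :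
    HasCellDecomposition E 1 1 :=
  ⟨fun _ => Set.univ, fun i j h => absurd (Subsingleton.elim i j) h,
    by simp [Set.iUnion_const], by simp, by simp⟩

theorem HasCellDecomposition.exists_mul {n M m : ℕ} {E : Finset (Fin n → ℝ)}
    {P : MvPolynomial (Fin n) ℝ} (h : HasCellDecomposition E M P) (hM : M < (m + 1) ^ n) :
    ∃ Q : MvPolynomial (Fin n) ℝ, Q ≠ 0 ∧ Q.totalDegree ≤ n * m ∧
      HasCellDecomposition E (M * 2) (P * Q) := by
  classical
  obtain ⟨Ω, hdisj, hcover, hfr, hcard⟩ := h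
  let c : E → ℕ := fun x => if h : ∃ i, (x : Fin n → ℝ) ∈ Ω i then (h.choose : ℕ) else M
  have hc : ∀ (x : E) (i : Fin M), c x = i ↔ (x : Fin n → ℝ) ∈ Ω i := by
    intro x i
    by_cases h : ∃ i, (x : Fin n → ℝ) ∈ Ω i
    · have hcx : c x = h.choose := dif_pos h
      rw [hcx, Fin.val_inj]
      constructor
      · rintro rfl
        exact h.choose_spec
      · intro hi
        by_contra hne
        exact Set.disjoint_left.1 (hdisj hne) h.choose_spec hi
    · have hcx : c x = M := dif_neg h
      rw [hcx]
      exact ⟨fun h' => absurd h' i.2.ne', fun h' => absurd ⟨i, h'⟩ h⟩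
  obtain ⟨Q, hQ0, hQdeg, hQ⟩ := exists_polynomial_halving n m M hM c fun x => (x : Fin n → ℝ)
  have hncard : ∀ (i : Fin M) (S : Set (Fin n → ℝ)),
      ((E : Set (Fin n → ℝ)) ∩ (Ω i ∩ S)).ncard =
        (univ.filter fun x : E => c x = i ∧ (x : Fin n → ℝ) ∈ S).card := by
    intro i S
    rw [← Set.ncard_coe_finset, ← Set.ncard_image_of_injective _ Subtype.val_injective]
    congr 1
    ext x
    simp [hc]
    tauto
  have hncard' : ∀ i : Fin M, ((E : Set (Fin n → ℝ)) ∩ Ω i).ncard =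
      (univ.filter fun x : E => c x = i).card := by
    intro i
    simpa using hncard i Set.univ
  let H : Fin 2 → Set (Fin n → ℝ) :=
    ![{x | 0 < MvPolynomial.eval x Q}, {x | MvPolynomial.eval x Q < 0}]
  have hcont : Continuous fun x : Fin n → ℝ => MvPolynomial.eval x Q :=
    MvPolynomial.continuous_eval Q
  have hHdisj : ∀ a b, a ≠ b → Disjoint (H a) (H b) := by
    have h01 : Disjoint (H 0) (H 1) := Set.disjoint_left.2 fun x h1 h2 =>
      lt_asymm (show 0 < MvPolynomial.eval x Q from h1) h2
    intro a b hab
    fin_cases a <;> fin_cases b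
    · exact absurd rfl hab
    · exact h01
    · exact h01.symm
    · exact absurd rfl hab
  have hHfr : ∀ a, frontier (H a) ⊆ {x | MvPolynomial.eval x Q = 0} := by
    intro a
    fin_cases a
    · exact (frontier_lt_subset_eq continuous_const hcont).trans fun x hx => Eq.symm hx
    · exact frontier_lt_subset_eq hcont continuous_const
  have hHcard : ∀ i a, 2 * ((E : Set (Fin n → ℝ)) ∩ (Ω i ∩ H a)).ncard ≤
      ((E : Set (Fin n → ℝ)) ∩ Ω i).ncard := by
    intro i a
    rw [hncard, hncard']
    fin_cases a
    · exact (hQ i i.2).1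
    · exact (hQ i i.2).2
  refine ⟨Q, hQ0, hQdeg,
    fun k => Ω (finProdFinEquiv.symm k).1 ∩ H (finProdFinEquiv.symm k).2, ?_, ?_, ?_, ?_⟩
  · intro k l hkl
    have hne : finProdFinEquiv.symm k ≠ finProdFinEquiv.symm l :=
      finProdFinEquiv.symm.injective.ne hkl
    change Disjoint (Ω (finProdFinEquiv.symm k).1 ∩ H (finProdFinEquiv.symm k).2)
      (Ω (finProdFinEquiv.symm l).1 ∩ H (finProdFinEquiv.symm l).2)
    generalize finProdFinEquiv.symm k = u at *
    generalize finProdFinEquiv.symm l = v at *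
    by_cases h1 : u.1 = v.1
    · have h2 : u.2 ≠ v.2 := fun h2 => hne (Prod.ext h1 h2)
      exact (hHdisj _ _ h2).mono Set.inter_subset_right Set.inter_subset_right
    · exact (hdisj h1).mono Set.inter_subset_left Set.inter_subset_left
  · refine (Set.eq_univ_of_forall fun x => ?_).symm
    have hx : x ∈ {x | MvPolynomial.eval x P = 0} ∪ ⋃ i, Ω i := hcover ▸ Set.mem_univ x
    rcases hx with hx | hx
    · left
      have hx : MvPolynomial.eval x P = 0 := hx
      simp [hx]
    · obtain ⟨i, hi⟩ := Set.mem_iUnion.1 hx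
      rcases lt_trichotomy (MvPolynomial.eval x Q) 0 with h | h | h
      · right
        exact Set.mem_iUnion.2 ⟨finProdFinEquiv (i, 1), by simpa [hi, H] using h⟩
      · left
        simp [h]
      · right
        exact Set.mem_iUnion.2 ⟨finProdFinEquiv (i, 0), by simpa [hi, H] using h⟩
  · intro k x hx
    rcases frontier_inter_subset _ _ hx with h | h
    · have : MvPolynomial.eval x P = 0 := hfr _ h.1
      simp [this]
    · have : MvPolynomial.eval x Q = 0 := hHfr _ h.2
      simp [this]
  · intro k
    calc M * 2 * _ = M * (2 * _) := mul_assoc _ _ _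
      _ ≤ M * _ := Nat.mul_le_mul_left M (hHcard _ _)
      _ ≤ _ := hcard _

theorem exists_hasCellDecomposition_two_pow {n : ℕ} (hn : 1 ≤ n) (E : Finset (Fin n → ℝ))
    (k : ℕ) : ∃ P : MvPolynomial (Fin n) ℝ, P ≠ 0 ∧
      (P.totalDegree : ℝ) + 2 * (n : ℝ) ^ 2 ≤
        2 * (n : ℝ) ^ 2 * ((2 : ℝ) ^ ((1 : ℝ) / n)) ^ k ∧
      HasCellDecomposition E (2 ^ k) P := by
  have hn0 : (0 : ℝ) < n := by exact_mod_cast hn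
  set r : ℝ := (2 : ℝ) ^ ((1 : ℝ) / n) with hr
  have hr0 : 0 < r := by positivity
  have hrn : r ^ n = 2 := by
    rw [hr, one_div, Real.rpow_inv_natCast_pow (by norm_num) (by omega)]
  have hr1 : 1 ≤ 2 * n * (r - 1) := by
    have h1 : Real.log 2 * (1 / n) + 1 ≤ r := by
      rw [hr, Real.rpow_def_of_pos (by norm_num)]
      exact Real.add_one_le_exp _
    have h2 := Real.log_two_gt_d9
    have h3 : Real.log 2 ≤ n * (r - 1) := by
      calc Real.log 2 = n * (Real.log 2 * (1 / n)) := by field_simp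
        _ ≤ n * (r - 1) := mul_le_mul_of_nonneg_left (by linarith) hn0.le
    linarith
  induction k with
  | zero => exact ⟨1, one_ne_zero, by simp, hasCellDecomposition_one E⟩
  | succ k ih =>
    obtain ⟨P, hP0, hPdeg, hP⟩ := ih
    obtain ⟨Q, hQ0, hQdeg, hQ⟩ := hP.exists_mul (m := ⌊r ^ k⌋₊) (by
      have h1 : (r ^ k) ^ n < ((⌊r ^ k⌋₊ : ℝ) + 1) ^ n :=
        pow_lt_pow_left₀ (Nat.lt_floor_add_one _) (by positivity) (by omega)
      rw [← pow_mul, mul_comm, pow_mul, hrn] at h1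
      exact_mod_cast h1)
    refine ⟨P * Q, mul_ne_zero hP0 hQ0, ?_, by rwa [pow_succ]⟩
    have h1 : ((P * Q).totalDegree : ℝ) ≤ P.totalDegree + Q.totalDegree := by
      exact_mod_cast MvPolynomial.totalDegree_mul P Q
    have h2 : (Q.totalDegree : ℝ) ≤ n * r ^ k := by
      calc (Q.totalDegree : ℝ) ≤ n * (⌊r ^ k⌋₊ : ℝ) := by exact_mod_cast hQdeg
        _ ≤ n * r ^ k := by
          gcongr
          exact Nat.floor_le (by positivity)
    have h3 : n * r ^ k * 1 ≤ n * r ^ k * (2 * n * (r - 1)) :=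
      mul_le_mul_of_nonneg_left hr1 (by positivity)
    rw [pow_succ r k]
    linarith

end CellDecomposition

/-- **Polynomial cell decomposition** (Theorem 6.6, Guth–Katz). -/
theorem polynomial_cell_decomposition : ∃ C : ℝ, 0 < C ∧ ∀ n : ℕ, 1 ≤ n →
    ∀ E : Finset (Fin n → ℝ), ∀ M : ℕ, (∃ k : ℕ, M = 2 ^ k) →
    ∃ P : MvPolynomial (Fin n) ℝ, P ≠ 0 ∧
      (P.totalDegree : ℝ) ≤ C * (n : ℝ) ^ 2 * (M : ℝ) ^ ((1 : ℝ) / n) ∧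
      ∃ Ω : Fin M → Set (Fin n → ℝ),
        (Pairwise fun i j => Disjoint (Ω i) (Ω j)) ∧
        (Set.univ : Set (Fin n → ℝ)) = {x | MvPolynomial.eval x P = 0} ∪ ⋃ i, Ω i ∧
        (∀ i, frontier (Ω i) ⊆ {x | MvPolynomial.eval x P = 0}) ∧
        (∀ i, M * ((E : Set (Fin n → ℝ)) ∩ Ω i).ncard ≤ E.card) := by
  refine ⟨2, two_pos, ?_⟩
  rintro n hn E M ⟨k, rfl⟩
  obtain ⟨P, hP0, hdeg, hP⟩ := exists_hasCellDecomposition_two_pow hn E k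
  refine ⟨P, hP0, ?_, hP⟩
  have hpow : (((2 ^ k : ℕ) : ℝ)) ^ ((1 : ℝ) / n) = ((2 : ℝ) ^ ((1 : ℝ) / n)) ^ k := by
    push_cast
    rw [← Real.rpow_natCast, ← Real.rpow_natCast, ← Real.rpow_mul (by norm_num),
      ← Real.rpow_mul (by norm_num), mul_comm]
  rw [hpow]
  have : (0 : ℝ) ≤ 2 * (n : ℝ) ^ 2 := by positivity
  linarith
end

section
/- There exist absolute constants C, c > 0 such that for all positive integers p and q, one has |3^p − 2^q| ≥ (c/q^C)·3^p. -/
/-- A prime dividing `n.choose k` is detected by a carry in the lowest digit. -/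
theorem Nat.Prime.dvd_choose_of_le_mod_add_mod {p n k : ℕ} (hp : p.Prime) (hkn : k ≤ n)
    (hpn : p ≤ n) (h : p ≤ k % p + (n - k) % p) : p ∣ n.choose k := by
  have hfac := Nat.factorization_choose hp hkn (Nat.lt_succ_self (Nat.log p n))
  refine Nat.dvd_of_factorization_pos (n := n.choose k) (p := p) ?_
  rw [hfac]
  refine (Finset.card_pos.2 ⟨1, ?_⟩).ne'
  have : 0 < Nat.log p n := Nat.log_pos hp.one_lt hpn
  simp only [Finset.mem_filter, Finset.mem_Ico, pow_one]
  exact ⟨⟨le_rfl, by omega⟩, h⟩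

/-- Every prime in `(k, 6k]` divides the multinomial coefficient `(6k)! / ((3k)! (2k)! k!)`. -/
theorem Nat.Prime.dvd_choose_mul_choose {p k : ℕ} (hp : p.Prime) (hk : k < p) (hpk : p ≤ 6 * k) :
    p ∣ (6 * k).choose (3 * k) * (3 * k).choose k := by
  have mod_eq {a : ℕ} (h₁ : p ≤ a) (h₂ : a < 2 * p) : a % p = a - p := by
    rw [Nat.mod_eq_sub_mod h₁, Nat.mod_eq_of_lt (by omega)]
  rcases lt_or_ge (3 * k) p with h3 | h3
  · refine (hp.dvd_choose_of_le_mod_add_mod (by omega) hpk ?_).mul_right _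
    rw [show 6 * k - 3 * k = 3 * k by omega, Nat.mod_eq_of_lt h3]
    omega
  rcases lt_or_ge (2 * k) p with h2 | h2
  · refine (hp.dvd_choose_of_le_mod_add_mod (by omega) h3 ?_).mul_left _
    rw [show 3 * k - k = 2 * k by omega, Nat.mod_eq_of_lt h2, Nat.mod_eq_of_lt hk]
    omega
  rcases lt_or_ge (3 * k) (2 * p) with h1 | h1
  · refine (hp.dvd_choose_of_le_mod_add_mod (by omega) hpk ?_).mul_right _
    rw [show 6 * k - 3 * k = 3 * k by omega, mod_eq h3 h1]
    omega
  · refine (hp.dvd_choose_of_le_mod_add_mod (by omega) h3 ?_).mul_left _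
    rw [show 3 * k - k = 2 * k by omega, Nat.mod_eq_of_lt hk, mod_eq h2 (by omega)]
    omega

theorem Nat.choose_mul_choose_le (k : ℕ) :
    (6 * k).choose (3 * k) * (3 * k).choose k ≤ 432 ^ k := by
  have h1 : (6 * k).choose (3 * k) ≤ 64 ^ k := by
    calc (6 * k).choose (3 * k) ≤ 2 ^ (6 * k) := Nat.choose_le_two_pow _ _
      _ = 64 ^ k := by rw [pow_mul]; norm_num
  have h2 : 4 ^ k * (3 * k).choose k ≤ 27 ^ k := by
    have h := add_pow (1 : ℕ) 2 (3 * k)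
    have hle := Finset.single_le_sum (f := fun m ↦ 1 ^ m * 2 ^ (3 * k - m) * (3 * k).choose m)
      (s := Finset.range (3 * k + 1)) (fun _ _ ↦ Nat.zero_le _)
      (Finset.mem_range.2 (show k < 3 * k + 1 by omega))
    simp only [Nat.cast_id] at h
    rw [← h, show 3 * k - k = 2 * k by omega, pow_mul, pow_mul] at hle
    simpa using hle
  refine Nat.le_of_mul_le_mul_left (c := 4 ^ k) ?_ (by positivity)
  calc 4 ^ k * ((6 * k).choose (3 * k) * (3 * k).choose k)
      = (6 * k).choose (3 * k) * (4 ^ k * (3 * k).choose k) := by ring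
    _ ≤ 64 ^ k * 27 ^ k := Nat.mul_le_mul h1 h2
    _ = 4 ^ k * 432 ^ k := by norm_num [← mul_pow]

theorem Chebyshev.theta_six_mul_le (k : ℕ) :
    Chebyshev.theta ((6 * k : ℕ) : ℝ) ≤ Chebyshev.theta (k : ℝ) + k * Real.log 432 := by
  have hprod : ∏ p ∈ Finset.Ioc k (6 * k) with p.Prime, p ≤ 432 ^ k := by
    refine (Nat.le_of_dvd ?_ (Finset.prod_primes_dvd _ ?_ ?_)).trans (Nat.choose_mul_choose_le k)
    · exact Nat.mul_pos (Nat.choose_pos (by omega)) (Nat.choose_pos (by omega))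
    · intro p hp
      exact (Finset.mem_filter.1 hp).2.prime
    · intro p hp
      simp only [Finset.mem_filter, Finset.mem_Ioc] at hp
      exact hp.2.dvd_choose_mul_choose hp.1.1 hp.1.2
  have hlog : ∑ p ∈ Finset.Ioc k (6 * k) with p.Prime, Real.log p ≤ k * Real.log 432 := by
    rw [← Real.log_prod (fun p hp ↦ by
      simpa using (Finset.mem_filter.1 hp).2.ne_zero), ← Real.log_pow]
    refine Real.log_le_log (Finset.prod_pos fun p hp ↦ ?_) ?_
    · exact_mod_cast (Finset.mem_filter.1 hp).2.pos
    · rw [← Nat.cast_prod]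
      exact_mod_cast hprod
  have hsplit : Finset.Ioc 0 (6 * k) = Finset.Ioc 0 k ∪ Finset.Ioc k (6 * k) :=
    (Finset.Ioc_union_Ioc_eq_Ioc (Nat.zero_le _) (by omega)).symm
  simp only [Chebyshev.theta, Nat.floor_natCast]
  rw [hsplit, Finset.filter_union, Finset.sum_union]
  · gcongr
  · refine Finset.disjoint_filter_filter (Finset.disjoint_left.2 fun a ha hb ↦ ?_)
    simp only [Finset.mem_Ioc] at ha hb
    omega

theorem Chebyshev.exists_theta_le {α : ℝ} (hα : Real.log 432 / 5 < α) :
    ∃ B : ℝ, ∀ n : ℕ, Chebyshev.theta (n : ℝ) ≤ α * n + B := by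
  have hlog : 0 < Real.log 432 := Real.log_pos (by norm_num)
  have hα0 : 0 < α := by linarith
  set ε := 5 * α - Real.log 432 with hε
  have hε0 : 0 < ε := by linarith
  obtain ⟨N, hN⟩ := exists_nat_gt ((6 * (α + Real.log 432)) / ε + 1)
  have hN1 : (1 : ℝ) < N := by
    have : 0 < 6 * (α + Real.log 432) / ε := by positivity
    linarith
  refine ⟨Chebyshev.theta (N + 6 : ℕ), fun n ↦ ?_⟩
  induction n using Nat.strong_induction_on with
  | _ n ih =>
    rcases le_or_gt n (N + 6) with hn | hn
    · have := Chebyshev.theta_mono (show (n : ℝ) ≤ (N + 6 : ℕ) by exact_mod_cast hn)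
      have : 0 ≤ α * n := by positivity
      linarith
    · have hk : n / 6 + 1 < n := by omega
      have h1 := Chebyshev.theta_mono (show (n : ℝ) ≤ (6 * (n / 6 + 1) : ℕ) by
        exact_mod_cast (by omega))
      have h2 := Chebyshev.theta_six_mul_le (n / 6 + 1)
      have h3 := ih _ hk
      have h4 : ((n / 6 + 1 : ℕ) : ℝ) ≤ n / 6 + 1 := by
        push_cast
        have := Nat.cast_div_le (α := ℝ) (m := n) (n := 6)
        push_cast at this
        linarith
      have h5 : (α + Real.log 432) * ((n / 6 + 1 : ℕ) : ℝ) ≤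
          (α + Real.log 432) * (n / 6 + 1) := by gcongr
      have h6 : 6 * (α + Real.log 432) ≤ ε * n := by
        have : (N : ℝ) < n := by exact_mod_cast (by omega)
        have : 6 * (α + Real.log 432) / ε < n := by linarith
        rw [div_lt_iff₀ hε0] at this
        linarith
      rw [hε] at h6
      linarith

theorem Chebyshev.exists_psi_le {α : ℝ} (hα : Real.log 432 / 5 < α) :
    ∃ B : ℝ, ∀ n : ℕ, Chebyshev.psi (n : ℝ) ≤ α * n + B := by
  obtain ⟨β, hβ, hβα⟩ := exists_between hα
  obtain ⟨B, hB⟩ := Chebyshev.exists_theta_le hβ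
  obtain ⟨C, hC⟩ := Chebyshev.psi_sub_theta_le_mul_sqrt
  have hδ : 0 < α - β := by linarith
  refine ⟨B + C ^ 2 / (4 * (α - β)), fun n ↦ ?_⟩
  have h1 := hB n
  have h2 := hC n
  have h3 : C * √(n : ℝ) ≤ (α - β) * n + C ^ 2 / (4 * (α - β)) := by
    rw [← sub_nonneg]
    have : (α - β) * n + C ^ 2 / (4 * (α - β)) - C * √(n : ℝ) =
        (2 * (α - β) * √(n : ℝ) - C) ^ 2 / (4 * (α - β)) := by
      field_simp
      have := Real.sq_sqrt (Nat.cast_nonneg (α := ℝ) n)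
      linear_combination (-4 * (α - β) ^ 2) * this
    rw [this]
    positivity
  linarith

theorem Nat.exists_lcmUpto_le :
    ∃ A : ℝ, 0 < A ∧ ∀ n : ℕ, ((3 * n + 1).lcmUpto : ℝ) ≤ A * 46 ^ n := by
  have hα : Real.log 432 / 5 < Real.log 46 / 3 := by
    have h : Real.log (432 ^ 3) < Real.log (46 ^ 5) := Real.log_lt_log (by norm_num) (by norm_num)
    rw [Real.log_pow, Real.log_pow] at h
    push_cast at h
    linarith
  obtain ⟨B, hB⟩ := Chebyshev.exists_psi_le hα
  refine ⟨Real.exp (Real.log 46 / 3 + B), Real.exp_pos _, fun n ↦ ?_⟩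
  have h := hB (3 * n + 1)
  rw [Chebyshev.psi_eq_log_lcmUpto] at h
  rw [← Real.exp_log (show (0 : ℝ) < (3 * n + 1).lcmUpto by
    exact_mod_cast Nat.lcmUpto_pos _)]
  calc Real.exp (Real.log (3 * n + 1).lcmUpto)
      ≤ Real.exp ((Real.log 46 / 3 + B) + n * Real.log 46) := by
        refine Real.exp_le_exp.2 (h.trans_eq ?_)
        push_cast
        ring
    _ = _ := by rw [Real.exp_add, Real.exp_nat_mul, Real.exp_log (by norm_num)]

open Polynomial

/-- The integer polynomial `(X - 9) * ((X - 8) * (X - 9) ^ 2 * (12 - X) ^ 3) ^ n`. -/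
noncomputable def logPoly (n : ℕ) : ℤ[X] :=
  (X - C 9) * ((X - C 8) * (X - C 9) ^ 2 * (C 12 - X) ^ 3) ^ n

theorem natDegree_logPoly_le (n : ℕ) : (logPoly n).natDegree ≤ 6 * n + 1 := by
  unfold logPoly
  have h : ((X - C 8) * (X - C 9) ^ 2 * (C 12 - X) ^ 3 : ℤ[X]).natDegree ≤ 6 := by compute_degree
  refine natDegree_mul_le.trans ?_
  have h1 : (X - C 9 : ℤ[X]).natDegree ≤ 1 := by compute_degree
  have h2 := natDegree_pow_le_of_le n h
  omega

theorem pow_dvd_logPoly_coeff_mul_pow {u : ℤ} (hu : u = 8 ∨ u = 9 ∨ u = 12) (n k : ℕ) :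
    u ^ (3 * n) ∣ (logPoly n).coeff k * u ^ k := by
  rw [← comp_C_mul_X_coeff]
  refine (C_dvd_iff_dvd_coeff _ _).1 ?_ k
  rw [logPoly, mul_comp, pow_comp, pow_mul, C_pow]
  refine Dvd.dvd.mul_left (pow_dvd_pow_of_dvd ?_ n) _
  simp only [mul_comp, pow_comp, sub_comp, X_comp, C_comp]
  rcases hu with rfl | rfl | rfl
  · refine ⟨(X - 1) * (C 8 * X - C 9) ^ 2 * (C 3 - C 2 * X) ^ 3, ?_⟩
    simp only [map_ofNat, map_pow]
    ring
  · refine ⟨C 3 * (C 9 * X - C 8) * (X - 1) ^ 2 * (C 4 - C 3 * X) ^ 3, ?_⟩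
    simp only [map_ofNat, map_pow]
    ring
  · refine ⟨C 36 * (C 3 * X - C 2) * (C 4 * X - C 3) ^ 2 * (1 - X) ^ 3, ?_⟩
    simp only [map_ofNat, map_pow]
    ring

/-- `Q` has nonnegative coefficients bounding those of `P` in absolute value. -/
def Polynomial.Majorizes (Q P : ℤ[X]) : Prop :=
  ∀ k, |P.coeff k| ≤ Q.coeff k

theorem Polynomial.Majorizes.mul {P Q P' Q' : ℤ[X]} (h : Q.Majorizes P) (h' : Q'.Majorizes P') :
    (Q * Q').Majorizes (P * P') := by
  intro k
  rw [coeff_mul, coeff_mul]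
  refine (Finset.abs_sum_le_sum_abs _ _).trans (Finset.sum_le_sum fun x _ ↦ ?_)
  rw [abs_mul]
  exact mul_le_mul (h _) (h' _) (abs_nonneg _) ((abs_nonneg _).trans (h _))

theorem Polynomial.Majorizes.pow {P Q : ℤ[X]} (h : Q.Majorizes P) (n : ℕ) :
    (Q ^ n).Majorizes (P ^ n) := by
  induction n with
  | zero =>
    intro k
    rw [pow_zero, pow_zero, coeff_one]
    split_ifs <;> simp
  | succ n ih =>
    rw [pow_succ, pow_succ]
    exact ih.mul h

theorem Polynomial.Majorizes.abs_coeff_le_eval_one {P Q : ℤ[X]} (h : Q.Majorizes P) (k : ℕ) :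
    |P.coeff k| ≤ Q.eval 1 := by
  have h0 (i : ℕ) : 0 ≤ Q.coeff i := (abs_nonneg _).trans (h i)
  refine (h k).trans ?_
  rw [eval_eq_sum_range' (n := max Q.natDegree k + 1) (by omega)]
  simp only [one_pow, mul_one]
  exact Finset.single_le_sum (f := Q.coeff) (fun i _ ↦ h0 i) (Finset.mem_range.2 (by omega))

theorem abs_coeff_logPoly_le (n k : ℕ) : |(logPoly n).coeff k| ≤ 10 * 1977300 ^ n := by
  have h1 {a : ℤ} (ha : 0 ≤ a) : (X + C a).Majorizes (X - C a) := by
    intro k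
    rw [coeff_add, coeff_sub, coeff_X, coeff_C]
    rw [abs_le]
    split_ifs <;> constructor <;> omega
  have h2 {a : ℤ} (ha : 0 ≤ a) : (X + C a).Majorizes (C a - X) := by
    intro k
    have := h1 ha k
    rwa [← neg_sub, coeff_neg, abs_neg]
  have h := ((h1 (show (0 : ℤ) ≤ 9 by norm_num)).mul
    (((h1 (show (0 : ℤ) ≤ 8 by norm_num)).mul ((h1 (show (0 : ℤ) ≤ 9 by norm_num)).pow 2)).mul
      ((h2 (show (0 : ℤ) ≤ 12 by norm_num)).pow 3) |>.pow n)).abs_coeff_le_eval_one k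
  refine h.trans_eq ?_
  simp only [eval_mul, eval_pow, eval_add, eval_X, eval_C]
  norm_num

theorem integral_eval_div_pow {P : ℤ[X]} {m : ℕ} {u v : ℝ} (hP : P.natDegree ≤ 2 * m + 1)
    (hu : 0 < u) (hv : 0 < v) :
    ∫ x in u..v, aeval x P / x ^ (m + 1) = P.coeff m * Real.log (v / u) +
      ∑ k ∈ (Finset.range (2 * m + 2)).erase m,
        (P.coeff k : ℝ) * ((v ^ ((k : ℤ) - m) - u ^ ((k : ℤ) - m)) / ((k : ℤ) - m : ℤ)) := by
  have h0 : (0 : ℝ) ∉ Set.uIcc u v := Set.notMem_uIcc_of_lt hu hv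
  have hint (k : ℕ) : ∫ x in u..v, (P.coeff k : ℝ) * x ^ ((k : ℤ) - m - 1) =
      if k = m then (P.coeff m : ℝ) * Real.log (v / u) else
        (P.coeff k : ℝ) * ((v ^ ((k : ℤ) - m) - u ^ ((k : ℤ) - m)) / ((k : ℤ) - m : ℤ)) := by
    rw [intervalIntegral.integral_const_mul]
    split_ifs with hk
    · subst hk
      simp only [sub_self, zero_sub, zpow_neg_one]
      rw [integral_inv h0]
    · rw [integral_zpow (Or.inr ⟨by omega, h0⟩)]
      simp
  have heq : ∀ x ∈ Set.uIcc u v, aeval x P / x ^ (m + 1) =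
      ∑ k ∈ Finset.range (2 * m + 2), (P.coeff k : ℝ) * x ^ ((k : ℤ) - m - 1) := by
    intro x hx
    have hx0 : x ≠ 0 := fun h ↦ h0 (h ▸ hx)
    rw [aeval_eq_sum_range' (n := 2 * m + 2) (by omega), Finset.sum_div]
    refine Finset.sum_congr rfl fun k _ ↦ ?_
    rw [zsmul_eq_mul, mul_div_assoc, sub_sub, zpow_sub₀ hx0]
    norm_cast
  rw [intervalIntegral.integral_congr heq, intervalIntegral.integral_finsetSum]
  · simp_rw [hint]
    rw [← Finset.add_sum_erase _ _ (Finset.mem_range.2 (show m < 2 * m + 2 by omega)), if_pos rfl]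
    congr 1
    exact Finset.sum_congr rfl fun k hk ↦ if_neg (Finset.ne_of_mem_erase hk)
  · intro k _
    exact (intervalIntegral.intervalIntegrable_zpow (Or.inr h0)).const_mul _

theorem exists_int_eq_mul_zpow {c u : ℤ} {m k : ℕ} (hu : u ≠ 0) (h : u ^ m ∣ c * u ^ k) :
    ∃ z : ℤ, (c : ℝ) * (u : ℝ) ^ ((k : ℤ) - m) = z := by
  obtain ⟨z, hz⟩ := h
  refine ⟨z, ?_⟩
  have hu' : (u : ℝ) ≠ 0 := by exact_mod_cast hu
  rw [zpow_sub₀ hu', zpow_natCast, zpow_natCast, ← mul_div_assoc, div_eq_iff (by positivity)]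
  rw [mul_comm (z : ℝ)]
  exact_mod_cast hz

theorem exists_int_lcmUpto_div {N : ℕ} {j : ℤ} (hj : j ≠ 0) (hjN : j.natAbs ≤ N) :
    ∃ z : ℤ, (N.lcmUpto : ℝ) / j = z := by
  have h : j ∣ (N.lcmUpto : ℤ) := by
    rw [← Int.natAbs_dvd_natAbs, Int.natAbs_natCast]
    exact Finset.dvd_lcm (f := id) (Finset.mem_Icc.2 ⟨Int.natAbs_pos.2 hj, hjN⟩)
  obtain ⟨z, hz⟩ := h
  refine ⟨z, ?_⟩
  have hj' : (j : ℝ) ≠ 0 := by exact_mod_cast hj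
  rw [div_eq_iff hj', mul_comm]
  exact_mod_cast hz

theorem exists_int_lcmUpto_mul_integral {P : ℤ[X]} {m : ℕ} {u v : ℤ} (hP : P.natDegree ≤ 2 * m + 1)
    (hu : 0 < u) (hv : 0 < v) (hPu : ∀ k, u ^ m ∣ P.coeff k * u ^ k)
    (hPv : ∀ k, v ^ m ∣ P.coeff k * v ^ k) :
    ∃ M : ℤ, ((m + 1).lcmUpto : ℝ) * ∫ x in (u : ℝ)..v, aeval x P / x ^ (m + 1) =
      (m + 1).lcmUpto * P.coeff m * Real.log (v / u) + M := by
  rw [integral_eval_div_pow hP (by exact_mod_cast hu) (by exact_mod_cast hv)]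
  have hterm : ∀ k ∈ (Finset.range (2 * m + 2)).erase m, ∃ z : ℤ, ((m + 1).lcmUpto : ℝ) *
      ((P.coeff k : ℝ) * (((v : ℝ) ^ ((k : ℤ) - m) - (u : ℝ) ^ ((k : ℤ) - m)) /
        ((k : ℤ) - m : ℤ))) = z := by
    intro k hk
    obtain ⟨hkm, hk⟩ := Finset.mem_erase.1 hk
    have hk := Finset.mem_range.1 hk
    obtain ⟨a, ha⟩ := exists_int_eq_mul_zpow hu.ne' (hPu k)
    obtain ⟨b, hb⟩ := exists_int_eq_mul_zpow hv.ne' (hPv k)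
    obtain ⟨d, hd⟩ := exists_int_lcmUpto_div (N := m + 1) (j := (k : ℤ) - m) (by omega) (by omega)
    refine ⟨d * (b - a), ?_⟩
    push_cast
    rw [← ha, ← hb, ← hd]
    push_cast
    ring
  choose! z hz using hterm
  refine ⟨∑ k ∈ (Finset.range (2 * m + 2)).erase m, z k, ?_⟩
  rw [mul_add, Finset.mul_sum, Finset.sum_congr rfl hz]
  push_cast
  ring

theorem aeval_logPoly_div_pow (n : ℕ) (x : ℝ) :
    aeval x (logPoly n) / x ^ (3 * n + 1) =
      (x - 9) / x * ((x - 8) * (x - 9) ^ 2 * (12 - x) ^ 3 / x ^ 3) ^ n := by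
  rw [div_pow, div_mul_div_comm, ← pow_mul, ← pow_succ']
  simp only [logPoly, map_mul, map_pow, map_sub, aeval_X, aeval_C]
  norm_num

theorem logKernel_nonneg {x : ℝ} (h8 : 8 ≤ x) (h12 : x ≤ 12) :
    0 ≤ (x - 8) * (x - 9) ^ 2 * (12 - x) ^ 3 / x ^ 3 := by
  have h1 : 0 ≤ x - 8 := by linarith
  have h2 : 0 ≤ 12 - x := by linarith
  positivity

theorem logKernel_le {x : ℝ} (h8 : 8 ≤ x) (h12 : x ≤ 12) :
    (x - 8) * (x - 9) ^ 2 * (12 - x) ^ 3 / x ^ 3 ≤ 1 / 50 := by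
  rw [div_le_div_iff₀ (by positivity) (by norm_num)]
  rcases le_total x 9 with h | h
  · obtain ⟨s, rfl⟩ : ∃ s, x = 8 + s := ⟨x - 8, by ring⟩
    have hs : 0 ≤ s := by linarith
    have hs' : 0 ≤ s * (1 - s) := mul_nonneg hs (by linarith)
    nlinarith [mul_nonneg hs' (sq_nonneg (s - 0.3)), mul_nonneg hs' (sq_nonneg (s ^ 2 - 0.3 * s)),
      sq_nonneg (s ^ 2 - 0.3 * s), sq_nonneg (s - 0.3),
      mul_nonneg hs (sq_nonneg (s ^ 2 - 0.3 * s)), mul_nonneg hs (sq_nonneg (s - 0.3)),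
      sq_nonneg (s ^ 3 - 0.3 * s ^ 2)]
  · obtain ⟨s, rfl⟩ : ∃ s, x = 9 + s := ⟨x - 9, by ring⟩
    have hs : 0 ≤ s := by linarith
    have hs' : 0 ≤ s * (3 - s) := mul_nonneg hs (by linarith)
    nlinarith [mul_nonneg hs' (sq_nonneg (s - 1.2)), mul_nonneg hs' (sq_nonneg (s ^ 2 - 1.2 * s)),
      sq_nonneg (s ^ 2 - 1.2 * s), sq_nonneg (s - 1.2),
      mul_nonneg hs (sq_nonneg (s ^ 2 - 1.2 * s)), mul_nonneg hs (sq_nonneg (s - 1.2)),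
      sq_nonneg (s ^ 3 - 1.2 * s ^ 2)]

theorem continuousOn_aeval_logPoly_div_pow (n : ℕ) {a b : ℝ} (ha : 0 < a) (hb : 0 < b) :
    ContinuousOn (fun x : ℝ ↦ aeval x (logPoly n) / x ^ (3 * n + 1)) (Set.uIcc a b) := by
  refine (Polynomial.continuous_aeval _).continuousOn.div (by fun_prop) fun x hx ↦ ?_
  have : 0 < x := (lt_min ha hb).trans_le hx.1
  positivity

theorem abs_integral_logPoly_le (n : ℕ) {a b : ℝ} (ha : 8 ≤ a) (hab : a ≤ b) (hb : b ≤ 12) :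
    |∫ x in a..b, aeval x (logPoly n) / x ^ (3 * n + 1)| ≤ (1 / 50) ^ n * (b - a) := by
  rw [← abs_of_nonneg (sub_nonneg.2 hab), ← Real.norm_eq_abs]
  refine intervalIntegral.norm_integral_le_of_norm_le_const fun x hx ↦ ?_
  rw [Set.uIoc_of_le hab] at hx
  have h8 : 8 ≤ x := by linarith [hx.1]
  have h12 : x ≤ 12 := hx.2.trans hb
  have hk := logKernel_nonneg h8 h12
  rw [aeval_logPoly_div_pow, Real.norm_eq_abs, abs_mul, abs_of_nonneg (pow_nonneg hk n)]
  have h1 : |(x - 9) / x| ≤ 1 := by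
    rw [abs_div, abs_of_pos (show 0 < x by linarith), div_le_one (by linarith), abs_le]
    constructor <;> linarith
  calc |(x - 9) / x| * _ ≤ 1 * (1 / 50) ^ n :=
        mul_le_mul h1 (pow_le_pow_left₀ hk (logKernel_le h8 h12) n) (pow_nonneg hk n) zero_le_one
    _ = _ := one_mul _

theorem integral_logPoly_nonneg (n : ℕ) :
    0 ≤ ∫ x in (9 : ℝ)..12, aeval x (logPoly n) / x ^ (3 * n + 1) := by
  refine intervalIntegral.integral_nonneg (by norm_num) fun x hx ↦ ?_
  rw [aeval_logPoly_div_pow]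
  exact mul_nonneg (div_nonneg (by linarith [hx.1]) (by linarith [hx.1]))
    (pow_nonneg (logKernel_nonneg (by linarith [hx.1]) hx.2) n)

theorem integral_logPoly_le_neg (n : ℕ) :
    ∫ x in (8 : ℝ)..9, aeval x (logPoly n) / x ^ (3 * n + 1) ≤ -(1 / 100 * (1 / 10000) ^ n) := by
  have hint {a b : ℝ} (ha : 0 < a) (hb : 0 < b) := (continuousOn_aeval_logPoly_div_pow n ha
    hb).intervalIntegrable (μ := MeasureTheory.volume)
  have hnonpos : ∀ x ∈ Set.Icc (8 : ℝ) 9, aeval x (logPoly n) / x ^ (3 * n + 1) ≤ 0 := by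
    intro x hx
    rw [aeval_logPoly_div_pow]
    exact mul_nonpos_of_nonpos_of_nonneg
      (div_nonpos_of_nonpos_of_nonneg (by linarith [hx.2]) (by linarith [hx.1]))
      (pow_nonneg (logKernel_nonneg hx.1 (by linarith [hx.2])) n)
  have hle : ∀ x ∈ Set.Icc (8.25 : ℝ) 8.75,
      aeval x (logPoly n) / x ^ (3 * n + 1) ≤ -(1 / 50 * (1 / 10000) ^ n) := by
    intro x hx
    obtain ⟨h1, h2⟩ := hx
    have h8 : 0 ≤ x - 8 := by linarith
    have h12 : 0 ≤ 12 - x := by linarith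
    have hk : 1 / 10000 ≤ (x - 8) * (x - 9) ^ 2 * (12 - x) ^ 3 / x ^ 3 := by
      have h3 : (0.25 : ℝ) * 0.25 ^ 2 * 3 ^ 3 / 9 ^ 3 ≤
          (x - 8) * (9 - x) ^ 2 * (12 - x) ^ 3 / x ^ 3 := by
        gcongr <;> linarith
      rw [show (x - 9) ^ 2 = (9 - x) ^ 2 by ring]
      refine le_trans (by norm_num) h3
    have hx9 : 1 / 50 ≤ (9 - x) / x := by
      rw [div_le_div_iff₀ (by norm_num) (by linarith)]
      linarith
    have := mul_le_mul hx9 (pow_le_pow_left₀ (by norm_num) hk n) (by positivity)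
      (le_trans (by norm_num) hx9)
    rw [aeval_logPoly_div_pow, show (x - 9) / x = -((9 - x) / x) by ring, neg_mul]
    linarith
  rw [← intervalIntegral.integral_add_adjacent_intervals (b := 8.25)
    (hint (by norm_num) (by norm_num)) (hint (by norm_num) (by norm_num)),
    ← intervalIntegral.integral_add_adjacent_intervals (a := 8.25) (b := 8.75)
    (hint (by norm_num) (by norm_num)) (hint (by norm_num) (by norm_num))]
  have hnp {a b : ℝ} (ha : 8 ≤ a) (hab : a ≤ b) (hb : b ≤ 9) :
      ∫ x in a..b, aeval x (logPoly n) / x ^ (3 * n + 1) ≤ 0 := by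
    rw [← neg_nonneg, ← intervalIntegral.integral_neg]
    exact intervalIntegral.integral_nonneg hab fun x hx ↦
      neg_nonneg.2 (hnonpos x ⟨ha.trans hx.1, hx.2.trans hb⟩)
  have hmid := intervalIntegral.integral_mono_on (a := (8.25 : ℝ)) (b := 8.75) (by norm_num)
    (hint (by norm_num) (by norm_num)) intervalIntegrable_const hle
  rw [intervalIntegral.integral_const, smul_eq_mul] at hmid
  have h1 := hnp (a := 8) (b := 8.25) (by norm_num) (by norm_num) (by norm_num)
  have h2 := hnp (a := 8.75) (b := 9) (by norm_num) (by norm_num) (by norm_num)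
  linarith

theorem exists_pow_lt_and_le_pow {A r s : ℝ} (hA : 0 < A) (hr0 : 0 < r) (hr1 : r < 1)
    (hs0 : 0 < s) (hs1 : s < 1) :
    ∃ C c : ℝ, 0 < C ∧ 0 < c ∧ ∀ q : ℕ, 0 < q →
      ∃ n : ℕ, A * q * r ^ n < 1 ∧ c / (q : ℝ) ^ C ≤ s ^ n := by
  have hC : 0 < Real.log s / Real.log r :=
    div_pos_of_neg_of_neg (Real.log_neg hs0 hs1) (Real.log_neg hr0 hr1)
  set C := Real.log s / Real.log r with hCdef
  have hrs : r ^ C = s := by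
    rw [Real.rpow_def_of_pos hr0, hCdef, mul_div_cancel₀ _ (Real.log_neg hr0 hr1).ne,
      Real.exp_log hs0]
  refine ⟨C, min 1 ((r / A) ^ C), hC, lt_min one_pos (by positivity), fun q hq ↦ ?_⟩
  have hq1 : (1 : ℝ) ≤ q := by exact_mod_cast hq
  have hqC : 1 ≤ (q : ℝ) ^ C := Real.one_le_rpow hq1 hC.le
  have hex : ∃ n : ℕ, A * q * r ^ n < 1 := by
    obtain ⟨n, hn⟩ := exists_pow_lt_of_lt_one (show 0 < 1 / (A * q) by positivity) hr1
    refine ⟨n, ?_⟩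
    rwa [lt_div_iff₀' (by positivity)] at hn
  classical
  refine ⟨Nat.find hex, Nat.find_spec hex, ?_⟩
  rcases hn : Nat.find hex with _ | n
  · rw [pow_zero, div_le_one (by positivity)]
    exact (min_le_left _ _).trans hqC
  · have hmin := not_lt.1 (Nat.find_min hex (show n < Nat.find hex by omega))
    have hle : r / A / q ≤ r ^ (n + 1) := by
      rw [div_div, div_le_iff₀ (by positivity), pow_succ]
      nlinarith
    calc min 1 ((r / A) ^ C) / (q : ℝ) ^ C ≤ (r / A) ^ C / (q : ℝ) ^ C := by
          gcongr
          exact min_le_right _ _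
      _ = (r / A / q) ^ C := (Real.div_rpow (by positivity) (by positivity) C).symm
      _ ≤ (r ^ (n + 1)) ^ C := Real.rpow_le_rpow (by positivity) hle hC.le
      _ = s ^ (n + 1) := by
        rw [← hrs, ← Real.rpow_natCast, ← Real.rpow_natCast, ← Real.rpow_mul hr0.le,
          ← Real.rpow_mul hr0.le, mul_comm]

theorem le_abs_mul_log_three_sub_mul_log_two {p q n : ℕ} {A : ℝ} (hq : q < 2 * p)
    (hp : 3 * p < 2 * q) (hA : ((3 * n + 1).lcmUpto : ℝ) ≤ A * 46 ^ n)
    (hn : 14 * A * q * (46 / 50) ^ n < 1) :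
    1 / 2000 * (1 / 10000 / 1977300) ^ n ≤ |p * Real.log 3 - q * Real.log 2| := by
  by_contra! hlt
  set D : ℝ := ((3 * n + 1).lcmUpto : ℝ) with hD
  have hD0 : 0 < D := Nat.cast_pos.2 (Nat.lcmUpto_pos _)
  set Q : ℝ := ((logPoly n).coeff (3 * n) : ℝ) with hQ
  set Λ : ℝ := p * Real.log 3 - q * Real.log 2 with hΛ
  obtain ⟨M₁, hM₁⟩ := exists_int_lcmUpto_mul_integral (P := logPoly n) (m := 3 * n) (u := 8)
    (v := 9) (by have := natDegree_logPoly_le n; omega) (by norm_num) (by norm_num)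
    (pow_dvd_logPoly_coeff_mul_pow (by norm_num) n) (pow_dvd_logPoly_coeff_mul_pow (by norm_num) n)
  obtain ⟨M₂, hM₂⟩ := exists_int_lcmUpto_mul_integral (P := logPoly n) (m := 3 * n) (u := 9)
    (v := 12) (by have := natDegree_logPoly_le n; omega) (by norm_num) (by norm_num)
    (pow_dvd_logPoly_coeff_mul_pow (by norm_num) n) (pow_dvd_logPoly_coeff_mul_pow (by norm_num) n)
  push_cast at hM₁ hM₂
  rw [← hD, ← hQ] at hM₁ hM₂
  have hI₁ := integral_logPoly_le_neg n
  have hI₂ := integral_logPoly_nonneg n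
  have hB₁ := abs_integral_logPoly_le n (a := 8) (b := 9) (by norm_num) (by norm_num) (by norm_num)
  have hB₂ := abs_integral_logPoly_le n (a := 9) (b := 12) (by norm_num) (by norm_num) (by norm_num)
  set I₁ := ∫ x in (8 : ℝ)..9, aeval x (logPoly n) / x ^ (3 * n + 1)
  set I₂ := ∫ x in (9 : ℝ)..12, aeval x (logPoly n) / x ^ (3 * n + 1)
  have hq' : (q : ℝ) + 1 ≤ 2 * p := by exact_mod_cast hq
  have hp' : (3 : ℝ) * p + 1 ≤ 2 * q := by exact_mod_cast hp
  have hlog : (2 * p - q) * Real.log (9 / 8) + (3 * p - 2 * q) * Real.log (12 / 9) = Λ := by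
    rw [show (9 / 8 : ℝ) = 3 ^ 2 / 2 ^ 3 by norm_num, show (12 / 9 : ℝ) = 2 ^ 2 / 3 by norm_num,
      Real.log_div (by norm_num) (by norm_num), Real.log_div (by norm_num) (by norm_num),
      Real.log_pow, Real.log_pow, Real.log_pow, hΛ]
    push_cast
    ring
  set S := (2 * p - q) * I₁ + (3 * p - 2 * q) * I₂ with hS
  have hM : (((2 * p - q) * M₁ + (3 * p - 2 * q) * M₂ : ℤ) : ℝ) = D * (S - Q * Λ) := by
    push_cast
    rw [← hlog, hS]
    linear_combination (-(2 * p - q : ℝ)) * hM₁ - (3 * p - 2 * q : ℝ) * hM₂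
  set ℓ : ℝ := 1 / 100 * (1 / 10000) ^ n with hℓ
  have hℓ0 : 0 < ℓ := by positivity
  have hS_le : S ≤ -ℓ := by
    have h1 : (2 * p - q - 1) * I₁ ≤ 0 :=
      mul_nonpos_of_nonneg_of_nonpos (by linarith) (by linarith)
    have h2 : (3 * p - 2 * q) * I₂ ≤ 0 := mul_nonpos_of_nonpos_of_nonneg (by linarith) hI₂
    linarith
  have hS_ge : -(7 * q * (1 / 50) ^ n) ≤ S := by
    have h₁ := neg_le_of_abs_le hB₁
    have h₂ := le_of_abs_le hB₂
    have h1 : (2 * p - q) * -((1 / 50) ^ n * (9 - 8)) ≤ (2 * p - q) * I₁ :=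
      mul_le_mul_of_nonneg_left h₁ (by linarith)
    have h2 : (2 * q - 3 * p) * I₂ ≤ (2 * q - 3 * p) * ((1 / 50) ^ n * (12 - 9)) :=
      mul_le_mul_of_nonneg_left h₂ (by linarith)
    have h3 : 0 ≤ (2 * q + 7 * p : ℝ) * (1 / 50) ^ n := by positivity
    linarith
  have hQΛ : |Q * Λ| ≤ ℓ / 2 := by
    have hQ_le : |Q| ≤ 10 * 1977300 ^ n := by
      rw [hQ]
      exact_mod_cast abs_coeff_logPoly_le n (3 * n)
    rw [abs_mul]
    calc |Q| * |Λ| ≤ 10 * 1977300 ^ n * (1 / 2000 * (1 / 10000 / 1977300) ^ n) := by gcongr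
      _ = ℓ / 2 := by
        rw [div_pow _ (1977300 : ℝ), hℓ]
        field_simp
        norm_num
  have hDS : D * (7 * q * (1 / 50) ^ n) < 1 / 2 := by
    calc D * (7 * q * (1 / 50) ^ n) ≤ A * 46 ^ n * (7 * q * (1 / 50) ^ n) := by gcongr
      _ = 14 * A * q * (46 / 50) ^ n / 2 := by
        rw [div_pow, div_pow, one_pow]
        ring
      _ < 1 / 2 := by linarith
  obtain ⟨h1, h2⟩ := abs_le.1 hQΛ
  have hneg : D * (S - Q * Λ) < 0 := mul_neg_of_pos_of_neg hD0 (by linarith)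
  have hgt : -1 < D * (S - Q * Λ) := by
    have h3 : D * -(3 / 2 * (7 * q * (1 / 50) ^ n)) ≤ D * (S - Q * Λ) :=
      mul_le_mul_of_nonneg_left (by linarith) hD0.le
    linarith
  rw [← hM] at hneg hgt
  have hneg' : (2 * p - q) * M₁ + (3 * p - 2 * q) * M₂ < 0 := by exact_mod_cast hneg
  have hgt' : -1 < (2 * p - q) * M₁ + (3 * p - 2 * q) * M₂ := by exact_mod_cast hgt
  omega

theorem exists_le_abs_mul_log_three_sub_mul_log_two :
    ∃ C c : ℝ, 0 < C ∧ 0 < c ∧ ∀ p q : ℕ, q < 2 * p → 3 * p < 2 * q →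
      c / (q : ℝ) ^ C ≤ |p * Real.log 3 - q * Real.log 2| := by
  obtain ⟨A, hA0, hA⟩ := Nat.exists_lcmUpto_le
  obtain ⟨C, c, hC, hc, h⟩ := exists_pow_lt_and_le_pow (A := 14 * A) (r := 46 / 50)
    (s := 1 / 10000 / 1977300) (by positivity) (by norm_num) (by norm_num) (by norm_num)
    (by norm_num)
  refine ⟨C, 1 / 2000 * c, hC, by positivity, fun p q hq hp ↦ ?_⟩
  obtain ⟨n, hn, hcn⟩ := h q (by omega)
  refine le_trans ?_ (le_abs_mul_log_three_sub_mul_log_two hq hp (hA n) hn)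
  rw [mul_div_assoc]
  gcongr

theorem half_le_abs_one_sub_exp_neg {x t : ℝ} (ht : t ≤ 1) (h : t ≤ |x|) :
    t / 2 ≤ |1 - Real.exp (-x)| := by
  rcases le_total 0 x with hx | hx
  · rw [abs_of_nonneg hx] at h
    refine le_trans ?_ (le_abs_self _)
    have h1 : Real.exp (-x) * (x + 1) ≤ 1 := by
      calc Real.exp (-x) * (x + 1) ≤ Real.exp (-x) * Real.exp x := by
            gcongr
            exact Real.add_one_le_exp x
        _ = 1 := by rw [← Real.exp_add, neg_add_cancel, Real.exp_zero]
    have h2 := Real.exp_pos (-x)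
    by_contra! hlt
    have h3 : 1 - t / 2 < Real.exp (-x) := by linarith
    have h4 : (1 - t / 2) * (x + 1) < 1 := by nlinarith
    nlinarith
  · rw [abs_of_nonpos hx] at h
    refine le_trans ?_ (neg_le_abs _)
    have := Real.add_one_le_exp (-x)
    linarith

/-- **Special case of Baker's theorem** (Theorem 7.2). -/
theorem baker_special_case : ∃ C c : ℝ, 0 < C ∧ 0 < c ∧
    ∀ p q : ℕ, 0 < p → 0 < q →
      c / (q : ℝ) ^ C * (3 : ℝ) ^ p ≤ |(3 : ℝ) ^ p - (2 : ℝ) ^ q| := by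
  obtain ⟨C, c, hC, hc, h⟩ := exists_le_abs_mul_log_three_sub_mul_log_two
  refine ⟨C, min c 1 / 20, hC, by positivity, fun p q hp hq ↦ ?_⟩
  have h3 : (0 : ℝ) < 3 ^ p := by positivity
  have hqC : 1 ≤ (q : ℝ) ^ C := Real.one_le_rpow (by exact_mod_cast hq) hC.le
  have ht1 : min c 1 / (q : ℝ) ^ C ≤ 1 := by
    rw [div_le_one (by positivity)]
    exact (min_le_right _ _).trans hqC
  have ht0 : 0 < min c 1 / (q : ℝ) ^ C := by positivity
  rw [div_right_comm]
  have hbig : (3 : ℝ) ^ p / 20 ≤ |(3 : ℝ) ^ p - (2 : ℝ) ^ q| →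
      min c 1 / (q : ℝ) ^ C / 20 * (3 : ℝ) ^ p ≤ |(3 : ℝ) ^ p - (2 : ℝ) ^ q| :=
    le_trans (by nlinarith)
  rcases le_or_gt (2 * p) q with hq2 | hq2
  · refine hbig (le_trans ?_ (neg_le_abs _))
    have h2 : (4 : ℝ) ^ p ≤ 2 ^ q := by
      calc (4 : ℝ) ^ p = 2 ^ (2 * p) := by rw [pow_mul]; norm_num
        _ ≤ 2 ^ q := pow_le_pow_right₀ (by norm_num) hq2
    have h43 : 4 / 3 * (3 : ℝ) ^ p ≤ 4 ^ p := by
      calc 4 / 3 * (3 : ℝ) ^ p ≤ (4 / 3) ^ p * 3 ^ p := by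
            gcongr
            exact le_self_pow₀ (by norm_num) hp.ne'
        _ = 4 ^ p := by rw [← mul_pow]; norm_num
    linarith
  rcases le_or_gt (2 * q) (3 * p) with hp3 | hp3
  · refine hbig (le_trans ?_ (le_abs_self _))
    have h2 : ((2 : ℝ) ^ q) ^ 2 ≤ 8 ^ p := by
      calc ((2 : ℝ) ^ q) ^ 2 = 2 ^ (2 * q) := by rw [← pow_mul, mul_comm]
        _ ≤ 2 ^ (3 * p) := pow_le_pow_right₀ (by norm_num) hp3
        _ = 8 ^ p := by rw [pow_mul]; norm_num
    have h89 : (8 : ℝ) ^ p ≤ 8 / 9 * (3 ^ p) ^ 2 := by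
      calc (8 : ℝ) ^ p = (8 / 9) ^ p * (3 ^ p) ^ 2 := by
            rw [← pow_mul, mul_comm p, pow_mul, ← mul_pow]
            norm_num
        _ ≤ 8 / 9 * (3 ^ p) ^ 2 := by
            gcongr
            exact pow_le_of_le_one (by norm_num) (by norm_num) hp.ne'
    have h4 : (2 : ℝ) ^ q ≤ 19 / 20 * 3 ^ p :=
      (sq_le_sq₀ (by positivity) (by positivity)).1 (by nlinarith)
    linarith
  · have hΛ : min c 1 / (q : ℝ) ^ C ≤ |p * Real.log 3 - q * Real.log 2| :=
      le_trans (by gcongr; exact min_le_left _ _) (h p q hq2 hp3)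
    have hexp := half_le_abs_one_sub_exp_neg ht1 hΛ
    have heq : (3 : ℝ) ^ p - 2 ^ q =
        (1 - Real.exp (-(p * Real.log 3 - q * Real.log 2))) * 3 ^ p := by
      rw [neg_sub, Real.exp_sub, Real.exp_nat_mul, Real.exp_nat_mul, Real.exp_log (by norm_num),
        Real.exp_log (by norm_num)]
      field_simp
    rw [heq, abs_mul, abs_of_pos h3]
    gcongr
    linarith
end
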